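/- arXiv:2406.15086 — 2 statements merged into one kernel-verified Lean document; each statement's English description precedes it below -/
import Mathlib

section
/- Assume additionally that the map x ∈ K₀ ↦ 𝔸^x := {(h,z) ∈ H×ℝᵐ : z ∈ A_{(h,x)}} is continuous for the Hausdorff distance on nonempty compact subsets of H×ℝᵐ (with the max metric). Then, given δ > 0, there exist T > 0 and an index k₀ with 2T < t₀/ε_{k₀} such that for every k ≥ k₀ and every τ ∈ [T, t₀/ε_k], dist(y_{ε_k}(τ), A^{x₀(ε_kτ)}_{g·τ}[δ]) ≤ δ, where A^x_h[δ] := ⋃{A_{(h̃,x)} : h̃ ∈ H, d(h̃,h) ≤ δ}. -/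
open Filter Topology Metric Set

noncomputable section

/-- The time-translate h·s of a map, as a continuous map. -/
def timeTranslate {n m : ℕ} (s : ℝ)
    (h : C(EuclideanSpace ℝ (Fin n) × EuclideanSpace ℝ (Fin m) × ℝ,
      EuclideanSpace ℝ (Fin m))) :
    C(EuclideanSpace ℝ (Fin n) × EuclideanSpace ℝ (Fin m) × ℝ,
      EuclideanSpace ℝ (Fin m)) :=
  ⟨fun p => h (p.1, p.2.1, p.2.2 + s), h.continuous.comp (by fun_prop)⟩

/-- Admissibility: bounded and uniformly continuous on K × ℝ for every compact K. -/
def IsAdmissibleMap {n m : ℕ}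
    (g : C(EuclideanSpace ℝ (Fin n) × EuclideanSpace ℝ (Fin m) × ℝ,
      EuclideanSpace ℝ (Fin m))) : Prop :=
  ∀ K : Set (EuclideanSpace ℝ (Fin n) × EuclideanSpace ℝ (Fin m)), IsCompact K →
    (∃ C : ℝ, ∀ x y (τ : ℝ), (x, y) ∈ K → ‖g (x, y, τ)‖ ≤ C) ∧
    (∀ ε > (0:ℝ), ∃ δ > (0:ℝ), ∀ x y (τ : ℝ) x' y' (τ' : ℝ), (x, y) ∈ K → (x', y') ∈ K →
      dist ((x, y, τ) : EuclideanSpace ℝ (Fin n) × EuclideanSpace ℝ (Fin m) × ℝ)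
        (x', y', τ') < δ → dist (g (x, y, τ)) (g (x', y', τ')) < ε)

/-- Uniform Lipschitz continuity in y on compact sets. -/
def IsLipschitzInY {n m : ℕ}
    (g : C(EuclideanSpace ℝ (Fin n) × EuclideanSpace ℝ (Fin m) × ℝ,
      EuclideanSpace ℝ (Fin m))) : Prop :=
  ∀ K₀ : Set (EuclideanSpace ℝ (Fin n)), IsCompact K₀ →
    ∀ K : Set (EuclideanSpace ℝ (Fin m)), IsCompact K →
      ∃ L > (0:ℝ), ∀ x ∈ K₀, ∀ y₁ ∈ K, ∀ y₂ ∈ K, ∀ τ : ℝ,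
        ‖g (x, y₁, τ) - g (x, y₂, τ)‖ ≤ L * ‖y₁ - y₂‖

/-- The compact tubular neighbourhood K₀ of the slow limit x₀. -/
def slowTube {n : ℕ} (x0 : ℝ → EuclideanSpace ℝ (Fin n)) (t₀ r : ℝ) :
    Set (EuclideanSpace ℝ (Fin n)) :=
  {z | ∃ t ∈ Set.Icc (0:ℝ) t₀, ∃ v : EuclideanSpace ℝ (Fin n), ‖v‖ ≤ r ∧ z = x0 t + v}

/-- The fiber A_{(h,x)}: initial values of bounded entire solutions of y' = h(x,y,τ). -/
def attrFiber {n m : ℕ} {H : Type*}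
    (ev : H → C(EuclideanSpace ℝ (Fin n) × EuclideanSpace ℝ (Fin m) × ℝ,
      EuclideanSpace ℝ (Fin m)))
    (h : H) (x : EuclideanSpace ℝ (Fin n)) : Set (EuclideanSpace ℝ (Fin m)) :=
  {z | ∃ y : ℝ → EuclideanSpace ℝ (Fin m), y 0 = z ∧ (∃ C, ∀ τ : ℝ, ‖y τ‖ ≤ C) ∧
    ∀ τ : ℝ, HasDerivAt y (ev h (x, y τ, τ)) τ}

/-- The parametrically inflated fiber A_{(h,x)}[δ] over the base H × K₀. -/
def inflFiber {n m : ℕ} {H : Type*} [MetricSpace H]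
    (ev : H → C(EuclideanSpace ℝ (Fin n) × EuclideanSpace ℝ (Fin m) × ℝ,
      EuclideanSpace ℝ (Fin m)))
    (K₀ : Set (EuclideanSpace ℝ (Fin n)))
    (h : H) (x : EuclideanSpace ℝ (Fin n)) (δ : ℝ) : Set (EuclideanSpace ℝ (Fin m)) :=
  ⋃ p ∈ {p : H × EuclideanSpace ℝ (Fin n) |
    p.2 ∈ K₀ ∧ max (dist h p.1) (dist x p.2) ≤ δ}, attrFiber ev p.1 p.2

/-- The inflated fiber Aˣ_h[δ] (inflation only in the hull variable). -/
def inflFiberH {n m : ℕ} {H : Type*} [MetricSpace H]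
    (ev : H → C(EuclideanSpace ℝ (Fin n) × EuclideanSpace ℝ (Fin m) × ℝ,
      EuclideanSpace ℝ (Fin m)))
    (h : H) (x : EuclideanSpace ℝ (Fin n)) (δ : ℝ) : Set (EuclideanSpace ℝ (Fin m)) :=
  ⋃ h' ∈ {h' : H | dist h' h ≤ δ}, attrFiber ev h' x

/-- The omega-limit set O(g₀) of g₀ for the flow σf. -/
def omegaSet {H : Type*} [TopologicalSpace H] (σf : ℝ → H → H) (g0 : H) : Set H :=
  ⋂ s ∈ Set.Ici (0:ℝ), closure {h : H | ∃ τ ≥ s, h = σf τ g0}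

/-- The parametrically inflated fiber over the base O(g) × K₀. -/
def inflFiberO {n m : ℕ} {H : Type*} [MetricSpace H]
    (ev : H → C(EuclideanSpace ℝ (Fin n) × EuclideanSpace ℝ (Fin m) × ℝ,
      EuclideanSpace ℝ (Fin m)))
    (σf : ℝ → H → H) (g0 : H)
    (K₀ : Set (EuclideanSpace ℝ (Fin n)))
    (h : H) (x : EuclideanSpace ℝ (Fin n)) (δ : ℝ) : Set (EuclideanSpace ℝ (Fin m)) :=
  ⋃ p ∈ {p : H × EuclideanSpace ℝ (Fin n) |
    p.1 ∈ omegaSet σf g0 ∧ p.2 ∈ K₀ ∧ max (dist h p.1) (dist x p.2) ≤ δ},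
      attrFiber ev p.1 p.2

end

theorem eventually_forall_dist_lt_of_isCompact
    {P Y : Type*} [TopologicalSpace P] [PseudoMetricSpace Y] {G : P → Y → ℝ → Y}
    (hG : Continuous fun q : P × Y × ℝ => G q.1 q.2.1 q.2.2) (p : P) {C : Set (Y × ℝ)}
    (hC : IsCompact C) {η : ℝ} (hη : 0 < η) :
    ∀ᶠ q in 𝓝 p, ∀ z ∈ C, dist (G q z.1 z.2) (G p z.1 z.2) < η := by
  refine hC.eventually_forall_of_forall_eventually fun z _ => ?_
  have hc : Continuous fun w : P × Y × ℝ => dist (G w.1 w.2.1 w.2.2) (G p w.2.1 w.2.2) :=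
    hG.dist (hG.comp (continuous_const.prodMk continuous_snd))
  exact hc.continuousAt.eventually (gt_mem_nhds (by simpa using hη))

section ContinuousDependence

variable {E : Type*} [NormedAddCommGroup E] [NormedSpace ℝ E]

/-- Grönwall comparison of a bounded exact solution with an approximate one, where the Lipschitz and
approximation bounds are only available on a neighbourhood of the exact solution. -/
theorem dist_le_of_approx_solution {F : ℝ → E → E} {u v v' : ℝ → E} {a b R γ η : ℝ} {K : NNReal}
    (hγ : 0 < γ) (hη : 0 ≤ η)
    (hF : ∀ t, LipschitzOnWith K (F t) (closedBall 0 (R + γ)))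
    (hu : ∀ t ∈ Icc a b, HasDerivAt u (F t (u t)) t) (huR : ∀ t ∈ Icc a b, ‖u t‖ ≤ R)
    (hv : ∀ t ∈ Icc a b, HasDerivAt v (v' t) t)
    (hv' : ∀ t ∈ Icc a b, ‖v t‖ ≤ R + γ → dist (v' t) (F t (v t)) ≤ η)
    (hini : dist (u a) (v a) ≤ η) (hbound : gronwallBound η K η (b - a) < γ) :
    ∀ t ∈ Icc a b, dist (u t) (v t) ≤ γ := by
  have huc : ContinuousOn u (Icc a b) := fun t ht => (hu t ht).continuousAt.continuousWithinAt
  have hvc : ContinuousOn v (Icc a b) := fun t ht => (hv t ht).continuousAt.continuousWithinAt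
  rcases lt_or_ge b a with hab | hab
  · intro t ht
    exact absurd (ht.1.trans ht.2) (not_le.2 hab)
  have hηγ : η < γ := by
    refine lt_of_le_of_lt ?_ hbound
    have := gronwallBound_mono hη hη K.coe_nonneg (sub_nonneg.2 hab)
    rwa [gronwallBound_x0] at this
  have hclosed : IsClosed ({t | dist (u t) (v t) ≤ γ} ∩ Icc a b) := by
    have : {t | dist (u t) (v t) ≤ γ} ∩ Icc a b
        = Icc a b ∩ (fun t => dist (u t) (v t)) ⁻¹' Iic γ := by
      ext t; simp [and_comm]
    rw [this]
    exact (continuous_dist.comp_continuousOn (huc.prodMk hvc)).preimage_isClosed_of_isClosed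
      isClosed_Icc isClosed_Iic
  refine hclosed.Icc_subset_of_forall_mem_nhdsGT_of_Icc_subset (hini.trans hηγ.le) ?_
  intro t ht hsub
  have htI : t ∈ Icc a b := Ico_subset_Icc_self ht
  have hI : ∀ s ∈ Icc a t, s ∈ Icc a b := fun s hs => ⟨hs.1, hs.2.trans ht.2.le⟩
  have hvR : ∀ s ∈ Icc a t, ‖v s‖ ≤ R + γ := fun s hs => by
    have h1 : dist (u s) (v s) ≤ γ := hsub hs
    have h2 := huR s (hI s hs)
    rw [dist_comm, dist_eq_norm] at h1
    linarith [norm_sub_norm_le (v s) (u s)]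
  have hgr := dist_le_of_approx_trajectories_ODE_of_mem (v := F) (K := K)
    (s := fun _ => closedBall 0 (R + γ)) (f := u) (g := v) (f' := fun s => F s (u s)) (g' := v')
    (a := a) (b := t) (εf := 0) (εg := η) (δ := η)
    (fun s _ => hF s) (huc.mono hI)
    (fun s hs => (hu s (hI s (Ico_subset_Icc_self hs))).hasDerivWithinAt)
    (fun s _ => by simp)
    (fun s hs => by
      have := huR s (hI s (Ico_subset_Icc_self hs))
      simp only [mem_closedBall_zero_iff]; linarith)
    (hvc.mono hI)
    (fun s hs => (hv s (hI s (Ico_subset_Icc_self hs))).hasDerivWithinAt)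
    (fun s hs => hv' s (hI s (Ico_subset_Icc_self hs)) (hvR s (Ico_subset_Icc_self hs)))
    (fun s hs => by simpa using hvR s (Ico_subset_Icc_self hs))
    hini t ⟨ht.1, le_rfl⟩
  rw [zero_add] at hgr
  have hlt : dist (u t) (v t) < γ :=
    (hgr.trans (gronwallBound_mono hη hη K.coe_nonneg (by linarith [ht.2]))).trans_lt hbound
  have hcont : ContinuousAt (fun s => dist (u s) (v s)) t :=
    (hu t htI).continuousAt.dist (hv t htI).continuousAt
  exact mem_nhdsWithin_of_mem_nhds ((hcont.eventually (gt_mem_nhds hlt)).mono fun s hs => hs.le)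

theorem exists_gronwallBound_lt (K x : ℝ) {γ : ℝ} (hγ : 0 < γ) :
    ∃ η > 0, gronwallBound η K η x < γ := by
  have hcont : Continuous fun η => gronwallBound η K η x := by
    unfold gronwallBound
    split_ifs <;> fun_prop
  have h0 : gronwallBound 0 K 0 x < γ := by simpa [gronwallBound_ε0_δ0] using hγ
  have h : ∀ᶠ η in 𝓝[>] (0 : ℝ), gronwallBound η K η x < γ :=
    mem_nhdsWithin_of_mem_nhds (hcont.continuousAt.eventually (gt_mem_nhds h0))
  obtain ⟨η, hη, hη0⟩ := (h.and self_mem_nhdsWithin).exists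
  exact ⟨η, hη0, hη⟩

variable {P : Type*} [TopologicalSpace P] {G : P → E → ℝ → E}

/-- Continuous dependence along a filter, for slowly varying parameters. -/
theorem eventually_forall_dist_le_of_tendsto [ProperSpace E]
    (hG : Continuous fun q : P × E × ℝ => G q.1 q.2.1 q.2.2)
    (hL : ∀ p R, ∃ K : NNReal, ∀ t, LipschitzOnWith K (fun y => G p y t) (closedBall 0 R))
    {p : P} {u : ℝ → E} {a b : ℝ}
    (hu : ∀ t ∈ Icc a b, HasDerivAt u (G p (u t) t) t)
    {ι : Type*} {l : Filter ι} {q : ι → ℝ → P} {v : ι → ℝ → E} {c : ι → ℝ}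
    (hc : ∀ᶠ i in l, c i ≤ b)
    (hq : ∀ U ∈ 𝓝 p, ∀ᶠ i in l, ∀ t ∈ Icc a (c i), q i t ∈ U)
    (hv : ∀ᶠ i in l, ∀ t ∈ Icc a (c i), HasDerivAt (v i) (G (q i t) (v i t) t) t)
    (hini : Tendsto (fun i => v i a) l (𝓝 (u a))) {γ : ℝ} (hγ : 0 < γ) :
    ∀ᶠ i in l, ∀ t ∈ Icc a (c i), dist (u t) (v i t) ≤ γ := by
  have huc : ContinuousOn u (Icc a b) := fun t ht => (hu t ht).continuousAt.continuousWithinAt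
  obtain ⟨R, hR⟩ := isCompact_Icc.exists_bound_of_continuousOn huc
  obtain ⟨K, hK⟩ := hL p (R + γ)
  obtain ⟨η, hη, hηγ⟩ := exists_gronwallBound_lt K (b - a) hγ
  have hU := eventually_forall_dist_lt_of_isCompact hG p
    ((isCompact_closedBall (0 : E) (R + γ)).prod (isCompact_Icc (a := a) (b := b))) hη
  filter_upwards [hc, hq _ hU, hv, hini.eventually (closedBall_mem_nhds _ hη)]
    with i hci hqi hvi hinii
  refine dist_le_of_approx_solution (F := fun t y => G p y t) (R := R) (K := K) hγ hη.le hK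
    (fun t ht => hu t ⟨ht.1, ht.2.trans hci⟩) (fun t ht => hR t ⟨ht.1, ht.2.trans hci⟩) hvi
    ?_ ?_ ?_
  · intro t ht hvt
    exact (hqi t ht (v i t, t) ⟨by simpa using hvt, ht.1, ht.2.trans hci⟩).le
  · rw [dist_comm]
    exact hinii
  · exact (gronwallBound_mono hη.le hη.le K.coe_nonneg (by linarith)).trans_lt hηγ

theorem norm_le_of_tendsto_parameter [ProperSpace E]
    (hG : Continuous fun q : P × E × ℝ => G q.1 q.2.1 q.2.2)
    (hL : ∀ p R, ∃ K : NNReal, ∀ t, LipschitzOnWith K (fun y => G p y t) (closedBall 0 R))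
    {p : P} {u : ℝ → E} {a b : ℝ} (hab : a ≤ b)
    (hu : ∀ t ∈ Icc a b, HasDerivAt u (G p (u t) t) t)
    {ι : Type*} {l : Filter ι} [l.NeBot] {q : ι → P} (hq : Tendsto q l (𝓝 p)) {v : ι → ℝ → E}
    (hv : ∀ i, ∀ t ∈ Icc a b, HasDerivAt (v i) (G (q i) (v i t) t) t)
    (hini : ∀ i, v i a = u a) {c : ℝ} (hvc : ∀ i, ‖v i b‖ ≤ c) : ‖u b‖ ≤ c := by
  refine le_of_forall_pos_le_add fun γ hγ => ?_
  obtain ⟨i, hi⟩ := (eventually_forall_dist_le_of_tendsto hG hL hu (l := l)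
    (q := fun i _ => q i) (v := v) (c := fun _ => b) (by simp)
    (fun U hU => (hq.eventually hU).mono fun i hi t _ => hi)
    (by simpa using Eventually.of_forall hv)
    (by simp [hini]) hγ).exists
  have := hi b ⟨hab, le_rfl⟩
  rw [dist_eq_norm] at this
  linarith [hvc i, norm_sub_norm_le (u b) (v i b)]

theorem eqOn_Icc_of_hasDerivAt [ProperSpace E]
    (hG : Continuous fun q : P × E × ℝ => G q.1 q.2.1 q.2.2)
    (hL : ∀ p R, ∃ K : NNReal, ∀ t, LipschitzOnWith K (fun y => G p y t) (closedBall 0 R))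
    {p : P} {u v : ℝ → E} {a b : ℝ}
    (hu : ∀ t ∈ Icc a b, HasDerivAt u (G p (u t) t) t)
    (hv : ∀ t ∈ Icc a b, HasDerivAt v (G p (v t) t) t) (hini : u a = v a) :
    EqOn u v (Icc a b) := by
  intro t ht
  refine dist_le_zero.1 (le_of_forall_pos_le_add fun γ hγ => ?_)
  have := eventually_forall_dist_le_of_tendsto hG hL hu (l := pure ())
    (q := fun _ _ => p) (v := fun _ => v) (c := fun _ => b) (by simp)
    (fun U hU => by simp [mem_of_mem_nhds hU]) (by simpa using hv) (by simp [hini]) hγ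
  simpa using (eventually_pure.1 this) t ht

/-- Consistent forward solutions starting at the times `-N` glue to an entire solution. -/
theorem exists_entire_solution [ProperSpace E]
    (hG : Continuous fun q : P × E × ℝ => G q.1 q.2.1 q.2.2)
    (hL : ∀ p R, ∃ K : NNReal, ∀ t, LipschitzOnWith K (fun y => G p y t) (closedBall 0 R))
    {p : P} {u : ℕ → ℝ → E}
    (hu : ∀ N : ℕ, ∀ t, -(N : ℝ) ≤ t → HasDerivAt (u N) (G p (u N t) t) t)
    (hcons : ∀ M N : ℕ, M ≤ N → u N (-M) = u M (-M)) :
    ∃ y : ℝ → E, (∀ t, HasDerivAt y (G p (y t) t) t) ∧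
      ∀ N : ℕ, ∀ t, -(N : ℝ) ≤ t → y t = u N t := by
  have hmono : ∀ M N : ℕ, M ≤ N → ∀ t, -(M : ℝ) ≤ t → u N t = u M t := by
    intro M N hMN t ht
    have hMN' : (M : ℝ) ≤ N := by exact_mod_cast hMN
    exact eqOn_Icc_of_hasDerivAt hG hL (fun s hs => hu N s (by linarith [hs.1]))
      (fun s hs => hu M s hs.1) (hcons M N hMN) ⟨ht, le_rfl⟩
  have hy : ∀ N : ℕ, ∀ t, -(N : ℝ) ≤ t → u ⌈|t|⌉₊ t = u N t := by
    intro N t ht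
    have h1 : -((⌈|t|⌉₊ : ℕ) : ℝ) ≤ t := by
      linarith [Nat.le_ceil |t|, neg_abs_le t]
    rcases le_total N ⌈|t|⌉₊ with h | h
    · exact hmono _ _ h t ht
    · exact (hmono _ _ h t h1).symm
  refine ⟨fun t => u ⌈|t|⌉₊ t, fun t => ?_, hy⟩
  obtain ⟨N, hN⟩ := exists_nat_gt (-t)
  have hlt : -(N : ℝ) < t := by linarith
  have heq : (fun t => u ⌈|t|⌉₊ t) =ᶠ[𝓝 t] u N :=
    (lt_mem_nhds hlt).mono fun s hs => hy N s (le_of_lt hs)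
  have := (hu N t hlt.le).congr_of_eventuallyEq heq
  rwa [← hy N t hlt.le] at this

end ContinuousDependence

theorem IsCompact.exists_tendsto_ultrafilter {X ι : Type*} [TopologicalSpace X] {K : Set X}
    (hK : IsCompact K) {l : Ultrafilter ι} {f : ι → X} (hf : ∀ᶠ i in (l : Filter ι), f i ∈ K) :
    ∃ x ∈ K, Tendsto f l (𝓝 x) :=
  hK.ultrafilter_le_nhds' (l.map f) hf

section SlowFast

/-- A nonautonomous vector field over a flow: continuous, locally Lipschitz in the state, and
equivariant under time translations. -/
structure IsFlowField {H X Y : Type*} [TopologicalSpace H] [TopologicalSpace X]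
    [NormedAddCommGroup Y] (σf : ℝ → H → H) (G : H × X → Y → ℝ → Y) : Prop where
  continuous : Continuous fun q : (H × X) × Y × ℝ => G q.1 q.2.1 q.2.2
  lipschitz : ∀ p R, ∃ K : NNReal, ∀ t, LipschitzOnWith K (fun y => G p y t) (closedBall 0 R)
  shift : ∀ s h x y t, G (σf s h, x) y t = G (h, x) y (t + s)

variable {H X Y : Type*} [PseudoMetricSpace X]
  [NormedAddCommGroup Y] [NormedSpace ℝ Y] {σf : ℝ → H → H} {G : H × X → Y → ℝ → Y}

/-- Solutions with parameters in `Q` are uniformly ultimately bounded by `c`. -/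
def IsUltimatelyBounded {P : Type*} (G : P → Y → ℝ → Y) (Q : Set P) (c : ℝ) : Prop :=
  ∀ d > (0 : ℝ), ∃ T > (0 : ℝ), ∀ p ∈ Q, ∀ (u : ℝ → Y) (a b : ℝ), a + T ≤ b →
    (∀ t ∈ Icc a b, HasDerivAt u (G p (u t) t) t) → ‖u a‖ ≤ d → ‖u b‖ ≤ c

theorem IsUltimatelyBounded.norm_le_of_bounded {P : Type*} {G : P → Y → ℝ → Y} {Q : Set P} {c : ℝ}
    (hB : IsUltimatelyBounded G Q c) {p : P} (hp : p ∈ Q) {y : ℝ → Y}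
    (hy : ∀ t, HasDerivAt y (G p (y t) t) t) {C : ℝ} (hC : ∀ t, ‖y t‖ ≤ C) (t : ℝ) :
    ‖y t‖ ≤ c := by
  obtain ⟨T, -, hT⟩ := hB (max C 1) (by positivity)
  exact hT p hp y (t - T) t (by simp) (fun s _ => hy s) ((hC _).trans (le_max_left _ _))

/-- A family of fast motions driven by slow components `xe k` converging to `x0` in the slow
time. -/
structure IsSlowFastFamily (G : H × X → Y → ℝ → Y) (g0 : H) (t₀ : ℝ) (ε : ℕ → ℝ)
    (xe : ℕ → ℝ → X) (ye : ℕ → ℝ → Y) (x0 : ℝ → X) : Prop where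
  pos : ∀ k, 0 < ε k
  lim : Tendsto ε atTop (𝓝 0)
  deriv : ∀ k : ℕ, ∀ τ ∈ Icc (0 : ℝ) (t₀ / ε k),
    HasDerivAt (ye k) (G (g0, xe k τ) (ye k τ) τ) τ
  continuousOn : ContinuousOn x0 (Icc 0 t₀)
  conv : TendstoUniformlyOn (fun k t => xe k (t / ε k)) x0 atTop (Icc 0 t₀)

variable {g0 : H} {t₀ : ℝ} {ε : ℕ → ℝ} {xe : ℕ → ℝ → X} {ye : ℕ → ℝ → Y} {x0 : ℝ → X}

theorem IsSlowFastFamily.mul_mem_Icc (S : IsSlowFastFamily G g0 t₀ ε xe ye x0) {k : ℕ} {τ : ℝ}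
    (hτ : τ ∈ Icc 0 (t₀ / ε k)) : ε k * τ ∈ Icc 0 t₀ := by
  have h := (le_div_iff₀ (S.pos k)).1 hτ.2
  exact ⟨mul_nonneg (S.pos k).le hτ.1, by linarith⟩

theorem IsSlowFastFamily.eventually_slow_mem (S : IsSlowFastFamily G g0 t₀ ε xe ye x0)
    {ι : Type*} {l : Filter ι} {κ : ι → ℕ} {τ c : ι → ℝ} {t a b : ℝ} (hκ : Tendsto κ l atTop)
    (ht : t ∈ Icc 0 t₀) (hτ : Tendsto (fun i => ε (κ i) * τ i) l (𝓝 t))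
    (ha : ∀ᶠ i in l, 0 ≤ τ i + a) (hc : ∀ᶠ i in l, c i ≤ b ∧ τ i + c i ≤ t₀ / ε (κ i))
    {U : Set X} (hU : U ∈ 𝓝 (x0 t)) :
    ∀ᶠ i in l, ∀ s ∈ Icc a (c i), xe (κ i) (τ i + s) ∈ U := by
  obtain ⟨η, hη, hηU⟩ := Metric.mem_nhds_iff.1 hU
  obtain ⟨ρ, hρ, hρx⟩ := Metric.continuousOn_iff.1 S.continuousOn t ht (η / 2) (half_pos hη)
  have h1 := hκ.eventually (Metric.tendstoUniformlyOn_iff.1 S.conv (η / 2) (half_pos hη))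
  have h2 : Tendsto (fun i => ε (κ i) * max |a| |b|) l (𝓝 0) := by
    simpa using (S.lim.comp hκ).mul_const (max |a| |b|)
  filter_upwards [h1, h2.eventually (gt_mem_nhds (half_pos hρ)),
    hτ.eventually (ball_mem_nhds t (half_pos hρ)), ha, hc] with i h1 h2 h3 h4 h5 s hs
  have hε := S.pos (κ i)
  have hmem := S.mul_mem_Icc (k := κ i) (τ := τ i + s)
    ⟨by linarith [hs.1], by linarith [hs.2, h5.2]⟩
  have hsb : |s| ≤ max |a| |b| := abs_le_max_abs_abs hs.1 (hs.2.trans h5.1)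
  have hx := h1 _ hmem
  rw [mul_div_cancel_left₀ _ hε.ne'] at hx
  have hdist : dist (ε (κ i) * (τ i + s)) t < ρ := by
    rw [Real.dist_eq] at h3 ⊢
    have hes : |ε (κ i) * s| ≤ ε (κ i) * max |a| |b| := by
      rw [abs_mul, abs_of_pos hε]
      gcongr
    calc |ε (κ i) * (τ i + s) - t| = |(ε (κ i) * τ i - t) + ε (κ i) * s| := by ring_nf
      _ ≤ |ε (κ i) * τ i - t| + |ε (κ i) * s| := abs_add_le _ _
      _ < ρ := by linarith
  apply hηU
  rw [mem_ball]
  linarith [dist_triangle_left (xe (κ i) (τ i + s)) (x0 t) (x0 (ε (κ i) * (τ i + s))),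
    hρx _ hmem hdist]

variable [TopologicalSpace H]

/-- Ultimate boundedness passes from one orbit to its closure. -/
theorem isUltimatelyBounded_of_denseRange [ProperSpace Y] (hG : IsFlowField σf G)
    {g0 : H} (hdense : DenseRange fun s => σf s g0) {Q : Set X}
    {sol : X → ℝ → Y → ℝ → Y} (hinit : ∀ x τ₀ y₀, sol x τ₀ y₀ τ₀ = y₀)
    (hsol : ∀ x τ₀ y₀ τ, τ₀ ≤ τ →
      HasDerivAt (sol x τ₀ y₀) (G (g0, x) (sol x τ₀ y₀ τ) τ) τ) {c : ℝ}
    (hB : ∀ d > (0 : ℝ), ∃ T > (0 : ℝ), ∀ x ∈ Q, ∀ τ₀ : ℝ, ∀ τ ≥ T, ∀ y₀ : Y, ‖y₀‖ ≤ d →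
      ‖sol x τ₀ y₀ (τ + τ₀)‖ ≤ c) :
    IsUltimatelyBounded G {p : H × X | p.2 ∈ Q} c := by
  intro d hd
  obtain ⟨T, hT0, hT⟩ := hB d hd
  refine ⟨T, hT0, ?_⟩
  rintro ⟨h, x⟩ hx u a b hab hu hua
  have hne : (comap (fun s => σf s g0) (𝓝 h)).NeBot := by
    rw [comap_neBot_iff_frequently]
    exact mem_closure_iff_frequently.1 (hdense h)
  refine norm_le_of_tendsto_parameter hG.continuous hG.lipschitz (by linarith) hu
    (l := comap (fun s => σf s g0) (𝓝 h)) (q := fun s => (σf s g0, x))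
    (v := fun s t => sol x (a + s) (u a) (t + s))
    (tendsto_comap.prodMk_nhds tendsto_const_nhds) ?_ (fun s => hinit _ _ _) ?_
  · intro s t ht
    rw [hG.shift]
    exact (hsol x (a + s) (u a) (t + s) (by linarith [ht.1])).comp_add_const t s
  · intro s
    have := hT x hx (a + s) (b - a) (by linarith) (u a) hua
    rwa [show b - a + (a + s) = b + s by ring] at this

/-- On bounded time windows the fast motions converge to a solution of a limiting frozen
equation. -/
theorem IsSlowFastFamily.eventually_dist_le [ProperSpace Y] (hG : IsFlowField σf G)
    (S : IsSlowFastFamily G g0 t₀ ε xe ye x0)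
    {ι : Type*} {l : Filter ι} {κ : ι → ℕ} {τ c : ι → ℝ} {t a b : ℝ} {h : H}
    (hκ : Tendsto κ l atTop) (ht : t ∈ Icc 0 t₀)
    (hτ : Tendsto (fun i => ε (κ i) * τ i) l (𝓝 t))
    (hh : Tendsto (fun i => σf (τ i) g0) l (𝓝 h))
    (ha : ∀ᶠ i in l, 0 ≤ τ i + a) (hc : ∀ᶠ i in l, c i ≤ b ∧ τ i + c i ≤ t₀ / ε (κ i))
    {u : ℝ → Y} (hu : ∀ s ∈ Icc a b, HasDerivAt u (G (h, x0 t) (u s) s) s)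
    (hini : Tendsto (fun i => ye (κ i) (τ i + a)) l (𝓝 (u a))) {γ : ℝ} (hγ : 0 < γ) :
    ∀ᶠ i in l, ∀ s ∈ Icc a (c i), dist (u s) (ye (κ i) (τ i + s)) ≤ γ := by
  refine eventually_forall_dist_le_of_tendsto hG.continuous hG.lipschitz hu
    (q := fun i s => (σf (τ i) g0, xe (κ i) (τ i + s))) (v := fun i s => ye (κ i) (τ i + s))
    (hc.mono fun i hi => hi.1) ?_ ?_ hini hγ
  · intro W hW
    obtain ⟨V, hV, U, hU, hVU⟩ := mem_nhds_prod_iff.1 hW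
    filter_upwards [hh.eventually hV, S.eventually_slow_mem hκ ht hτ ha hc hU] with i h1 h2 s hs
    exact hVU ⟨h1, h2 s hs⟩
  · filter_upwards [ha, hc] with i h1 h2 s hs
    rw [hG.shift, add_comm s]
    exact (S.deriv (κ i) (τ i + s)
      ⟨by linarith [hs.1], by linarith [hs.2, h2.2]⟩).comp_const_add (τ i) s

variable [CompactSpace H]

theorem IsSlowFastFamily.exists_step_bound [ProperSpace Y] (hG : IsFlowField σf G)
    (S : IsSlowFastFamily G g0 t₀ ε xe ye x0)
    (hex : ∀ p y₀ (τ₀ : ℝ), ∃ u : ℝ → Y, u τ₀ = y₀ ∧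
      ∀ τ, τ₀ ≤ τ → HasDerivAt u (G p (u τ) τ) τ) {c d T : ℝ}
    (hT : ∀ p ∈ {p : H × X | p.2 ∈ x0 '' Icc 0 t₀}, ∀ (u : ℝ → Y) (a b : ℝ), a + T ≤ b →
      (∀ t ∈ Icc a b, HasDerivAt u (G p (u t) t) t) → ‖u a‖ ≤ d → ‖u b‖ ≤ c) :
    ∃ N : ℕ, ∀ k ≥ N, ∀ τ ≥ (0 : ℝ), ‖ye k τ‖ ≤ d → ∀ s ∈ Icc 0 T, τ + s ≤ t₀ / ε k →
      ‖ye k (τ + s)‖ ≤ N ∧ (s = T → ‖ye k (τ + s)‖ ≤ c + 1) := by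
  by_contra! hcon
  choose κ hκ τ hτ0 hd s hs hsτ hbad using hcon
  have hmem : ∀ i, ε (κ i) * τ i ∈ Icc 0 t₀ := fun i =>
    S.mul_mem_Icc ⟨hτ0 i, by linarith [(hs i).1, hsτ i]⟩
  have hle : (↑(hyperfilter ℕ) : Filter ℕ) ≤ atTop := Nat.hyperfilter_le_atTop
  have hκt : Tendsto κ (hyperfilter ℕ) atTop := (tendsto_atTop_mono hκ tendsto_id).mono_left hle
  obtain ⟨t, ht, htt⟩ := isCompact_Icc.exists_tendsto_ultrafilter (l := hyperfilter ℕ)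
    (Eventually.of_forall hmem)
  obtain ⟨h, -, hht⟩ := isCompact_univ.exists_tendsto_ultrafilter (l := hyperfilter ℕ)
    (f := fun i => σf (τ i) g0) (by simp)
  obtain ⟨y, hy, hyt⟩ := (isCompact_closedBall (0 : Y) d).exists_tendsto_ultrafilter
    (l := hyperfilter ℕ) (f := fun i => ye (κ i) (τ i))
    (Eventually.of_forall fun i => by simpa using hd i)
  obtain ⟨u, hu0, hu⟩ := hex (h, x0 t) y 0
  have huc : ContinuousOn u (Icc 0 T) := fun s hs => (hu s hs.1).continuousAt.continuousWithinAt
  obtain ⟨R, hR⟩ := isCompact_Icc.exists_bound_of_continuousOn huc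
  have huT : ‖u T‖ ≤ c := hT (h, x0 t) ⟨t, ht, rfl⟩ u 0 T (by simp) (fun s hs => hu s hs.1)
    (by simpa [hu0] using hy)
  have key := S.eventually_dist_le hG (l := hyperfilter ℕ) (a := 0) (b := T) (c := s) hκt ht htt
    hht (by simpa using Eventually.of_forall hτ0)
    (Eventually.of_forall fun i => ⟨(hs i).2, hsτ i⟩) (fun s hs => hu s hs.1)
    (by simpa [hu0] using hyt) one_pos
  obtain ⟨i, hi, hiR⟩ := (key.and (hle ((eventually_ge_atTop ⌈R + 1⌉₊)))).exists
  have h1 := hi (s i) ⟨(hs i).1, le_rfl⟩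
  rw [dist_comm, dist_eq_norm] at h1
  have h2 := norm_sub_norm_le (ye (κ i) (τ i + s i)) (u (s i))
  have h3 : R + 1 ≤ i := (Nat.le_ceil _).trans (by exact_mod_cast hiR)
  obtain ⟨h4, h5⟩ := hbad i (by linarith [hR (s i) (hs i)])
  rw [h4] at h1 h2 h5
  linarith

theorem IsSlowFastFamily.exists_bound [ProperSpace Y] (hG : IsFlowField σf G)
    (S : IsSlowFastFamily G g0 t₀ ε xe ye x0)
    (hex : ∀ p y₀ (τ₀ : ℝ), ∃ u : ℝ → Y, u τ₀ = y₀ ∧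
      ∀ τ, τ₀ ≤ τ → HasDerivAt u (G p (u τ) τ) τ) {c : ℝ}
    (hB : IsUltimatelyBounded G {p : H × X | p.2 ∈ x0 '' Icc 0 t₀} c)
    {yInit : Y} (hye0 : ∀ k, ye k 0 = yInit) :
    ∃ N : ℕ, ∀ k ≥ N, ∀ τ ∈ Icc 0 (t₀ / ε k), ‖ye k τ‖ ≤ N := by
  obtain ⟨T, hT0, hT⟩ := hB (max (max (c + 1) ‖yInit‖) 1) (by positivity)
  obtain ⟨N, hN⟩ := S.exists_step_bound hG hex hT
  refine ⟨N, fun k hk τ hτ => ?_⟩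
  have hgrid : ∀ i : ℕ, i * T ≤ t₀ / ε k → ‖ye k (i * T)‖ ≤ max (max (c + 1) ‖yInit‖) 1 := by
    intro i
    induction i with
    | zero => simp [hye0]
    | succ i ih =>
      intro hi
      push_cast at hi ⊢
      rw [add_one_mul] at hi ⊢
      have := (hN k hk (i * T) (by positivity) (ih (by linarith)) T ⟨hT0.le, le_rfl⟩ hi).2 rfl
      exact this.trans ((le_max_left _ _).trans (le_max_left _ _))
  have h1 : ⌊τ / T⌋₊ * T ≤ τ := (le_div_iff₀ hT0).1 (Nat.floor_le (div_nonneg hτ.1 hT0.le))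
  have h2 : τ < (⌊τ / T⌋₊ + 1) * T := (div_lt_iff₀ hT0).1 (Nat.lt_floor_add_one _)
  have := (hN k hk (⌊τ / T⌋₊ * T) (by positivity) (hgrid _ (h1.trans hτ.2)) (τ - ⌊τ / T⌋₊ * T)
    ⟨by linarith, by linarith⟩ (by linarith [hτ.2])).1
  simpa using this

/-- Along times tending to infinity the fast motions accumulate at bounded entire solutions of a
limiting frozen equation. -/
theorem IsSlowFastFamily.exists_entire_limit [ProperSpace Y] (hG : IsFlowField σf G)
    (S : IsSlowFastFamily G g0 t₀ ε xe ye x0)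
    (hex : ∀ p y₀ (τ₀ : ℝ), ∃ u : ℝ → Y, u τ₀ = y₀ ∧
      ∀ τ, τ₀ ≤ τ → HasDerivAt u (G p (u τ) τ) τ) {c : ℝ}
    (hB : IsUltimatelyBounded G {p : H × X | p.2 ∈ x0 '' Icc 0 t₀} c) {R : ℝ}
    {ι : Type*} {l : Ultrafilter ι} {κ : ι → ℕ} {τ : ι → ℝ} (hκ : Tendsto κ l atTop)
    (hτ : Tendsto τ l atTop) (hmem : ∀ i, τ i ∈ Icc 0 (t₀ / ε (κ i)))
    (hR : ∀ i, ∀ s ∈ Icc 0 (t₀ / ε (κ i)), ‖ye (κ i) s‖ ≤ R) :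
    ∃ (h : H) (t : ℝ) (y : ℝ → Y), t ∈ Icc 0 t₀ ∧ Tendsto (fun i => σf (τ i) g0) l (𝓝 h) ∧
      Tendsto (fun i => ε (κ i) * τ i) l (𝓝 t) ∧ Tendsto (fun i => ye (κ i) (τ i)) l (𝓝 (y 0)) ∧
      (∃ C, ∀ s, ‖y s‖ ≤ C) ∧ ∀ s, HasDerivAt y (G (h, x0 t) (y s) s) s := by
  obtain ⟨t, ht, htt⟩ := isCompact_Icc.exists_tendsto_ultrafilter (l := l)
    (f := fun i => ε (κ i) * τ i) (Eventually.of_forall fun i => S.mul_mem_Icc (hmem i))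
  obtain ⟨h, -, hht⟩ := isCompact_univ.exists_tendsto_ultrafilter (l := l)
    (f := fun i => σf (τ i) g0) (by simp)
  have hnonneg : ∀ N : ℕ, ∀ᶠ i in (l : Filter ι), 0 ≤ τ i + -(N : ℝ) := fun N => by
    filter_upwards [hτ.eventually_ge_atTop (N : ℝ)] with i hi
    linarith
  have hlim : ∀ N : ℕ, ∃ w ∈ closedBall (0 : Y) R,
      Tendsto (fun i => ye (κ i) (τ i + -(N : ℝ))) l (𝓝 w) := fun N =>
    (isCompact_closedBall (0 : Y) R).exists_tendsto_ultrafilter <| by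
        filter_upwards [hnonneg N] with i hi
        rw [mem_closedBall_zero_iff]
        exact hR i _ ⟨hi, by linarith [(hmem i).2, N.cast_nonneg (α := ℝ)]⟩
  choose w hwR hw using hlim
  choose u hu0 hu using fun N : ℕ => hex (h, x0 t) (w N) (-(N : ℝ))
  have hcons : ∀ M N : ℕ, M ≤ N → u N (-M) = u M (-M) := by
    intro M N hMN
    have hMN' : (M : ℝ) ≤ N := by exact_mod_cast hMN
    have hconv : Tendsto (fun i => ye (κ i) (τ i + -(M : ℝ))) l (𝓝 (u N (-M))) := by
      refine Metric.nhds_basis_closedBall.tendsto_right_iff.2 fun γ hγ => ?_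
      have := S.eventually_dist_le hG (l := (l : Filter ι)) (a := -(N : ℝ)) (b := 0)
        (c := fun _ => 0) hκ ht htt hht
        (hnonneg N) (Eventually.of_forall fun i => ⟨le_rfl, by simpa using (hmem i).2⟩)
        (fun s hs => hu N s hs.1) (by simpa [hu0] using hw N) hγ
      filter_upwards [this] with i hi
      rw [mem_closedBall, dist_comm]
      exact hi _ ⟨by linarith, by simp⟩
    rw [hu0 M]
    exact tendsto_nhds_unique hconv (hw M)
  obtain ⟨y, hy, hyu⟩ := exists_entire_solution hG.continuous hG.lipschitz hu hcons
  refine ⟨h, t, y, ht, hht, htt, ?_, ⟨c, fun s => ?_⟩, hy⟩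
  · have h0 := hyu 0 0 (by simp)
    have h1 := hu0 0
    have h2 := hw 0
    simp only [Nat.cast_zero, neg_zero, add_zero] at h1 h2
    rwa [h0, h1]
  · obtain ⟨T, -, hT⟩ := hB (max R 1) (by positivity)
    obtain ⟨N, hN⟩ := exists_nat_ge (T - s)
    refine hT (h, x0 t) ⟨t, ht, rfl⟩ y (-N) s (by linarith) (fun r _ => hy r) ?_
    rw [hyu N _ le_rfl, hu0]
    exact (mem_closedBall_zero_iff.1 (hwR N)).trans (le_max_left _ _)

end SlowFast

theorem isFlowField_of_hull {n m : ℕ}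
    {g : C(EuclideanSpace ℝ (Fin n) × EuclideanSpace ℝ (Fin m) × ℝ, EuclideanSpace ℝ (Fin m))}
    (hlip : IsLipschitzInY g) {H : Type*} [TopologicalSpace H] {σf : ℝ → H → H}
    {ev : H → C(EuclideanSpace ℝ (Fin n) × EuclideanSpace ℝ (Fin m) × ℝ,
      EuclideanSpace ℝ (Fin m))}
    (hev : Continuous ev) (hrange : Set.range ev ⊆ closure {h | ∃ s : ℝ, h = timeTranslate s g})
    (hequiv : ∀ (s : ℝ) (h : H), ev (σf s h) = timeTranslate s (ev h)) :
    IsFlowField σf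
      fun (p : H × EuclideanSpace ℝ (Fin n)) (y : EuclideanSpace ℝ (Fin m)) (t : ℝ) =>
        ev p.1 (p.2, y, t) where
  continuous := by fun_prop
  lipschitz := by
    rintro ⟨h, x⟩ R
    obtain ⟨L, hL0, hL⟩ := hlip {x} isCompact_singleton _ (isCompact_closedBall 0 R)
    refine ⟨L.toNNReal, fun t => LipschitzOnWith.of_dist_le_mul fun y₁ h₁ y₂ h₂ => ?_⟩
    have hclosed : IsClosed {F : C(EuclideanSpace ℝ (Fin n) × EuclideanSpace ℝ (Fin m) × ℝ,
        EuclideanSpace ℝ (Fin m)) | ‖F (x, y₁, t) - F (x, y₂, t)‖ ≤ L * ‖y₁ - y₂‖} :=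
      isClosed_le (by fun_prop) continuous_const
    have hsub := closure_minimal (s := {h | ∃ s : ℝ, h = timeTranslate s g}) (by
      rintro _ ⟨s, rfl⟩
      exact hL x rfl y₁ h₁ y₂ h₂ (t + s)) hclosed
    rw [Real.coe_toNNReal L hL0.le, dist_eq_norm, dist_eq_norm]
    exact hsub (hrange ⟨h, rfl⟩)
  shift s h x y t := by
    rw [hequiv]
    rfl

theorem denseRange_orbit_of_hull {n m : ℕ}
    {g : C(EuclideanSpace ℝ (Fin n) × EuclideanSpace ℝ (Fin m) × ℝ, EuclideanSpace ℝ (Fin m))}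
    {H : Type*} [TopologicalSpace H] {σf : ℝ → H → H}
    {ev : H → C(EuclideanSpace ℝ (Fin n) × EuclideanSpace ℝ (Fin m) × ℝ,
      EuclideanSpace ℝ (Fin m))}
    (hev : IsInducing ev) (hrange : Set.range ev ⊆ closure {h | ∃ s : ℝ, h = timeTranslate s g})
    {g0 : H} (hg0 : ev g0 = g)
    (hequiv : ∀ (s : ℝ) (h : H), ev (σf s h) = timeTranslate s (ev h)) :
    DenseRange fun s => σf s g0 := by
  intro h
  rw [hev.closure_eq_preimage_closure_image]
  have : ev '' range (fun s => σf s g0) = {h | ∃ s : ℝ, h = timeTranslate s g} := by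
    ext F
    simp [hequiv, hg0, eq_comm]
  rw [mem_preimage, this]
  exact hrange ⟨h, rfl⟩

theorem isBounded_setOf_mem_attrFiber {n m : ℕ} {H : Type*} [MetricSpace H] [CompactSpace H]
    {ev : H → C(EuclideanSpace ℝ (Fin n) × EuclideanSpace ℝ (Fin m) × ℝ,
      EuclideanSpace ℝ (Fin m))} {Q : Set (EuclideanSpace ℝ (Fin n))} {c : ℝ}
    (hB : IsUltimatelyBounded
      (fun (p : H × EuclideanSpace ℝ (Fin n)) (y : EuclideanSpace ℝ (Fin m)) (t : ℝ) =>
        ev p.1 (p.2, y, t)) {p | p.2 ∈ Q} c)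
    {x : EuclideanSpace ℝ (Fin n)} (hx : x ∈ Q) :
    Bornology.IsBounded {p : H × EuclideanSpace ℝ (Fin m) | p.2 ∈ attrFiber ev p.1 x} := by
  refine (isCompact_univ.prod (isCompact_closedBall 0 c)).isBounded.subset ?_
  rintro ⟨h, z⟩ ⟨y, rfl, ⟨C, hC⟩, hy⟩
  exact ⟨mem_univ _, mem_closedBall_zero_iff.2
    (hB.norm_le_of_bounded (p := (h, x)) hx hy hC 0)⟩

/-- under continuity of x ↦ 𝔸ˣ, the fast motion tracks the inflated fibers Aˣ_h[δ]. -/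
theorem stmt_12
    {n m : ℕ} (hn : 1 ≤ n) (hm : 1 ≤ m)
    -- g, admissible and Lipschitz in y on compacts
    (g : C(EuclideanSpace ℝ (Fin n) × EuclideanSpace ℝ (Fin m) × ℝ,
      EuclideanSpace ℝ (Fin m)))
    (hadm : IsAdmissibleMap g) (hlip : IsLipschitzInY g)
    -- the hull H of g, a compact metric space with the continuous shift flow,
    -- identified via the embedding ev with the closure of the translates of g
    (H : Type) [MetricSpace H] [CompactSpace H]
    (σf : ℝ → H → H)
    (hσcont : Continuous fun p : ℝ × H => σf p.1 p.2)
    (hσ0 : ∀ h, σf 0 h = h)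
    (hσadd : ∀ s t : ℝ, ∀ h, σf (s + t) h = σf s (σf t h))
    (ev : H → C(EuclideanSpace ℝ (Fin n) × EuclideanSpace ℝ (Fin m) × ℝ,
      EuclideanSpace ℝ (Fin m)))
    (hev : Topology.IsEmbedding ev)
    (hrange : Set.range ev = closure {h | ∃ s : ℝ, h = timeTranslate s g})
    (g0 : H) (hg0 : ev g0 = g)
    (hequiv : ∀ (s : ℝ) (h : H), ev (σf s h) = timeTranslate s (ev h))
    -- the (unique, maximal) solutions y(τ,h,x,τ₀,y₀) of y' = h(x,y,τ)
    (sol : H → EuclideanSpace ℝ (Fin n) → ℝ → EuclideanSpace ℝ (Fin m) → ℝ →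
      EuclideanSpace ℝ (Fin m))
    (hsolinit : ∀ h x τ₀ y₀, sol h x τ₀ y₀ τ₀ = y₀)
    -- (H1): all solutions over the hull are globally defined in the future
    (hsolode : ∀ h x (τ₀ : ℝ) y₀ (τ : ℝ), τ₀ ≤ τ →
      HasDerivAt (sol h x τ₀ y₀) (ev h (x, sol h x τ₀ y₀ τ, τ)) τ)
    -- (H2): uniform ultimate boundedness over compact sets of parameters
    (hH2 : ∀ K₀ : Set (EuclideanSpace ℝ (Fin n)), IsCompact K₀ →
      ∃ c > (0:ℝ), ∀ d > (0:ℝ), ∃ T > (0:ℝ), ∀ x ∈ K₀, ∀ τ₀ : ℝ, ∀ τ ≥ T,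
        ∀ y₀ : EuclideanSpace ℝ (Fin m), ‖y₀‖ ≤ d → ‖sol g0 x τ₀ y₀ (τ + τ₀)‖ ≤ c)
    -- the slow vector field f, continuous and of linear growth
    (f : EuclideanSpace ℝ (Fin n) → EuclideanSpace ℝ (Fin m) → EuclideanSpace ℝ (Fin n))
    (hf : Continuous fun p : EuclideanSpace ℝ (Fin n) × EuclideanSpace ℝ (Fin m) =>
      f p.1 p.2)
    (a b : ℝ) (ha : 0 < a) (hb : 0 < b)
    (hgrowth : ∀ x y, ‖f x y‖ ≤ a + b * ‖x‖)
    -- initial data, final slow time, the sequence ε_k ↓ 0, and the solutions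
    -- (x_{ε_k}, y_{ε_k}) of the slow-fast system in the fast time
    (xInit : EuclideanSpace ℝ (Fin n)) (yInit : EuclideanSpace ℝ (Fin m))
    (t₀ : ℝ) (ht₀ : 0 < t₀)
    (ε : ℕ → ℝ) (hεpos : ∀ k, 0 < ε k) (hεanti : StrictAnti ε)
    (hεlim : Tendsto ε atTop (𝓝 0))
    (xe : ℕ → ℝ → EuclideanSpace ℝ (Fin n)) (ye : ℕ → ℝ → EuclideanSpace ℝ (Fin m))
    (hxe0 : ∀ k, xe k 0 = xInit) (hye0 : ∀ k, ye k 0 = yInit)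
    (hxeode : ∀ k : ℕ, ∀ τ ∈ Set.Icc (0:ℝ) (t₀ / ε k),
      HasDerivAt (xe k) (ε k • f (xe k τ) (ye k τ)) τ)
    (hyeode : ∀ k : ℕ, ∀ τ ∈ Set.Icc (0:ℝ) (t₀ / ε k),
      HasDerivAt (ye k) (g (xe k τ, ye k τ, τ)) τ)
    -- the slow components converge uniformly (in the slow time) to x₀
    (x0 : ℝ → EuclideanSpace ℝ (Fin n)) (hx0cont : ContinuousOn x0 (Set.Icc 0 t₀))
    (hconv : TendstoUniformlyOn (fun k t => xe k (t / ε k)) x0 atTop (Set.Icc 0 t₀))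
    -- the radius of the compact tube K₀ around x₀
    (r : ℝ) (hr : 0 < r)
    -- continuity of x ↦ 𝔸ˣ for the Hausdorff distance
    (hcont : ∀ x ∈ slowTube x0 t₀ r,
      Tendsto (fun x' => Metric.hausdorffDist
          {p : H × EuclideanSpace ℝ (Fin m) | p.2 ∈ attrFiber ev p.1 x'}
          {p : H × EuclideanSpace ℝ (Fin m) | p.2 ∈ attrFiber ev p.1 x})
        (𝓝[slowTube x0 t₀ r] x) (𝓝 0))
    (δ : ℝ) (hδ : 0 < δ) :
    ∃ T > (0:ℝ), ∃ k₀ : ℕ, 2 * T < t₀ / ε k₀ ∧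
      ∀ k ≥ k₀, ∀ τ ∈ Set.Icc T (t₀ / ε k),
        Metric.infDist (ye k τ)
          (inflFiberH ev (σf τ g0) (x0 (ε k * τ)) δ) ≤ δ := by
  have hG := isFlowField_of_hull hlip hev.continuous hrange.subset hequiv
  have hdense := denseRange_orbit_of_hull hev.isInducing hrange.subset hg0 hequiv
  have S : IsSlowFastFamily
      (fun (p : H × EuclideanSpace ℝ (Fin n)) (y : EuclideanSpace ℝ (Fin m)) (t : ℝ) =>
        ev p.1 (p.2, y, t)) g0 t₀ ε xe ye x0 :=
    { pos := hεpos
      lim := hεlim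
      deriv := by simpa only [hg0] using hyeode
      continuousOn := hx0cont
      conv := hconv }
  obtain ⟨c, -, hc⟩ := hH2 _ (isCompact_Icc.image_of_continuousOn hx0cont)
  have hB := isUltimatelyBounded_of_denseRange hG hdense (Q := x0 '' Icc 0 t₀) (sol := sol g0)
    (hsolinit g0) (hsolode g0) hc
  have hex : ∀ (p : H × EuclideanSpace ℝ (Fin n)) y₀ (τ₀ : ℝ),
      ∃ u : ℝ → EuclideanSpace ℝ (Fin m), u τ₀ = y₀ ∧
        ∀ τ, τ₀ ≤ τ → HasDerivAt u (ev p.1 (p.2, u τ, τ)) τ := fun p y₀ τ₀ =>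
    ⟨sol p.1 p.2 τ₀ y₀, hsolinit _ _ _ _, hsolode _ _ _ _⟩
  obtain ⟨N, hN⟩ := S.exists_bound hG hex hB hye0
  have hlarge : Tendsto (fun k => t₀ / ε k) atTop atTop :=
    (tendsto_nhdsWithin_iff.2 ⟨hεlim, Eventually.of_forall hεpos⟩ : Tendsto ε atTop (𝓝[>] 0)
      ).inv_tendsto_nhdsGT_zero.const_mul_atTop ht₀
  by_contra! hcon
  have hcon' : ∀ i : ℕ, ∃ k ≥ max i N, ∃ τ ∈ Icc ((i : ℝ) + 1) (t₀ / ε k),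
      δ < infDist (ye k τ) (inflFiberH ev (σf τ g0) (x0 (ε k * τ)) δ) := by
    intro i
    obtain ⟨k₀, hk₀, hk₀N⟩ := ((hlarge.eventually_gt_atTop (2 * ((i : ℝ) + 1))).and
      (eventually_ge_atTop (max i N))).exists
    obtain ⟨k, hk, h⟩ := hcon ((i : ℝ) + 1) (by positivity) k₀ hk₀
    exact ⟨k, hk₀N.trans hk, h⟩
  choose κ hκ τ hτ hinf using hcon'
  have hle : (↑(hyperfilter ℕ) : Filter ℕ) ≤ atTop := Nat.hyperfilter_le_atTop
  have hτ0 : ∀ i, τ i ∈ Icc 0 (t₀ / ε (κ i)) := fun i =>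
    ⟨by linarith [(hτ i).1, i.cast_nonneg (α := ℝ)], (hτ i).2⟩
  have hκt : Tendsto κ (hyperfilter ℕ) atTop :=
    (tendsto_atTop_mono (fun i => (le_max_left _ _).trans (hκ i)) tendsto_id).mono_left hle
  have hτt : Tendsto τ (hyperfilter ℕ) atTop :=
    (tendsto_atTop_mono (fun i => by linarith [(hτ i).1])
      tendsto_natCast_atTop_atTop).mono_left hle
  obtain ⟨h, t, y, ht, hht, htt, hyt, hybdd, hy⟩ := S.exists_entire_limit hG hex hB hκt hτt hτ0
    (fun i => hN _ ((le_max_right _ _).trans (hκ i)))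
  have hmem : ∀ i, ε (κ i) * τ i ∈ Icc 0 t₀ := fun i => S.mul_mem_Icc (hτ0 i)
  have htube : ∀ s ∈ Icc 0 t₀, x0 s ∈ slowTube x0 t₀ r := fun s hs =>
    ⟨s, hs, 0, by simpa using hr.le, by simp⟩
  have hxt : Tendsto (fun i => x0 (ε (κ i) * τ i)) (hyperfilter ℕ)
      (𝓝[slowTube x0 t₀ r] x0 t) :=
    tendsto_nhdsWithin_iff.2 ⟨(hx0cont t ht).tendsto.comp
      (tendsto_nhdsWithin_iff.2 ⟨htt, Eventually.of_forall hmem⟩),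
      Eventually.of_forall fun i => htube _ (hmem i)⟩
  have hδ2 : 0 < δ / 2 := half_pos hδ
  obtain ⟨i, hi₁, hi₂, hi₃⟩ := ((((hcont _ (htube t ht)).comp hxt).eventually
    (gt_mem_nhds hδ2)).and ((hht.eventually (ball_mem_nhds _ hδ2)).and
      (hyt.eventually (ball_mem_nhds _ hδ2)))).exists
  have hne : (inflFiberH ev (σf (τ i) g0) (x0 (ε (κ i) * τ i)) δ).Nonempty := by
    by_contra hne
    have := hinf i
    rw [not_nonempty_iff_eq_empty.1 hne, infDist_empty] at this
    linarith
  obtain ⟨z₀, hz₀⟩ := hne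
  obtain ⟨h₀, -, hz₀⟩ := mem_iUnion₂.1 hz₀
  have hlimit : (h, y 0) ∈ {p : H × EuclideanSpace ℝ (Fin m) | p.2 ∈ attrFiber ev p.1 (x0 t)} :=
    ⟨y, rfl, hybdd, hy⟩
  obtain ⟨⟨h', z'⟩, hz', hdist⟩ := exists_dist_lt_of_hausdorffDist_lt' hlimit hi₁
    (hausdorffEDist_ne_top_of_nonempty_of_bounded ⟨(h₀, z₀), hz₀⟩ ⟨_, hlimit⟩
      (isBounded_setOf_mem_attrFiber hB ⟨_, hmem i, rfl⟩)
      (isBounded_setOf_mem_attrFiber hB ⟨t, ht, rfl⟩))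
  obtain ⟨hdh, hdz⟩ : dist h' h < δ / 2 ∧ dist z' (y 0) < δ / 2 :=
    max_lt_iff.1 (Prod.dist_eq.symm.trans_lt hdist)
  have hz'mem : z' ∈ inflFiberH ev (σf (τ i) g0) (x0 (ε (κ i) * τ i)) δ := by
    refine mem_iUnion₂.2 ⟨h', ?_, hz'⟩
    have := dist_triangle_right h' (σf (τ i) g0) h
    change dist h' (σf (τ i) g0) ≤ δ
    linarith
  have h1 := infDist_le_dist_of_mem (x := ye (κ i) (τ i)) hz'mem
  have h2 := dist_triangle_right (ye (κ i) (τ i)) z' (y 0)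
  linarith [hinf i]
end

section
/- Assume additionally that the map (h,x) ∈ H×K₀ ↦ A_{(h,x)} is continuous for the Hausdorff distance on nonempty compact subsets of ℝᵐ. Then, given δ > 0, there exist T > 0 and an index k₀ with 2T < t₀/ε_{k₀} such that for every k ≥ k₀ and every τ ∈ [T, t₀/ε_k], dist(y_{ε_k}(τ), A_{(g·τ, x₀(ε_kτ))}) ≤ δ. -/
open Filter Topology Metric Set

theorem gronwallBound_eq_mul (η K x : ℝ) :
    gronwallBound η K η x = η * gronwallBound 1 K 1 x := by
  unfold gronwallBound
  split_ifs <;> ring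

theorem gronwallBound_one_pos {K x : ℝ} (hK : 0 ≤ K) (hx : 0 ≤ x) :
    0 < gronwallBound 1 K 1 x := by
  have h := gronwallBound_mono zero_le_one zero_le_one hK hx
  rw [gronwallBound_x0] at h
  linarith

/-- An approximate solution starting close to a solution `z` stays close to it, provided the
resulting error keeps it inside a ball where the vector field is Lipschitz. -/
theorem dist_le_of_approx_solution_s14 {E : Type*} [NormedAddCommGroup E] [NormedSpace ℝ E]
    {G : ℝ → E → E} {K : NNReal} {R η a b : ℝ} {y z y' : ℝ → E}
    (hG : ∀ t ∈ Icc a b, LipschitzOnWith K (G t) (closedBall 0 R))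
    (hz : ∀ t ∈ Icc a b, HasDerivAt z (G t (z t)) t)
    (hzR : ∀ t ∈ Icc a b, ‖z t‖ + 1 ≤ R)
    (hy : ∀ t ∈ Icc a b, HasDerivAt y (y' t) t)
    (hyG : ∀ t ∈ Icc a b, ‖y t‖ ≤ R → dist (y' t) (G t (y t)) ≤ η)
    (h0 : dist (y a) (z a) ≤ η) (hη : η * gronwallBound 1 K 1 (b - a) < 1) :
    ∀ t ∈ Icc a b, dist (y t) (z t) ≤ η * gronwallBound 1 K 1 (b - a) := by
  have hη0 : 0 ≤ η := dist_nonneg.trans h0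
  have hcy : ContinuousOn y (Icc a b) := fun t ht => (hy t ht).continuousAt.continuousWithinAt
  have hcz : ContinuousOn z (Icc a b) := fun t ht => (hz t ht).continuousAt.continuousWithinAt
  have key : ∀ c ∈ Icc a b, (∀ t ∈ Ico a c, dist (y t) (z t) < 1) →
      dist (y c) (z c) ≤ η * gronwallBound 1 K 1 (b - a) := by
    intro c hc hlt
    have hsub : ∀ t ∈ Ico a c, t ∈ Icc a b := fun t ht => ⟨ht.1, ht.2.le.trans hc.2⟩
    have hyR : ∀ t ∈ Ico a c, ‖y t‖ ≤ R := fun t ht => by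
      have h1 := hzR t (hsub t ht)
      have h2 := hlt t ht
      rw [dist_eq_norm] at h2
      have h3 := norm_sub_norm_le (y t) (z t)
      linarith
    have := dist_le_of_approx_trajectories_ODE_of_mem (v := G) (K := K)
      (s := fun _ => closedBall 0 R) (f := y) (g := z) (f' := y') (g' := fun t => G t (z t))
      (a := a) (b := c) (δ := η) (εf := η) (εg := 0)
      (fun t ht => hG t (hsub t ht)) (hcy.mono (Icc_subset_Icc_right hc.2))
      (fun t ht => (hy t (hsub t ht)).hasDerivWithinAt)
      (fun t ht => hyG t (hsub t ht) (hyR t ht))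
      (fun t ht => by simpa using hyR t ht) (hcz.mono (Icc_subset_Icc_right hc.2))
      (fun t ht => (hz t (hsub t ht)).hasDerivWithinAt)
      (fun t ht => by simp)
      (fun t ht => by
        have := hzR t (hsub t ht)
        simp only [mem_closedBall, dist_zero_right]
        linarith) h0 c ⟨hc.1, le_rfl⟩
    rw [add_zero, gronwallBound_eq_mul] at this
    refine this.trans (mul_le_mul_of_nonneg_left ?_ hη0)
    exact gronwallBound_mono zero_le_one zero_le_one K.2 (by linarith [hc.2])
  have hall : ∀ t ∈ Icc a b, dist (y t) (z t) < 1 := by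
    by_contra! hcon
    obtain ⟨t₁, ht₁, hd⟩ := hcon
    have hcl : IsCompact {t ∈ Icc a b | 1 ≤ dist (y t) (z t)} :=
      isCompact_Icc.of_isClosed_subset
        ((continuous_dist.comp_continuousOn (hcy.prodMk hcz)).preimage_isClosed_of_isClosed isClosed_Icc isClosed_Ici)
        (fun t ht => ht.1)
    obtain ⟨c, ⟨hc, hc1⟩, hmin⟩ := hcl.exists_isLeast ⟨t₁, ht₁, hd⟩
    refine absurd (key c hc fun t ht => ?_) (by linarith)
    by_contra! h
    exact absurd (hmin ⟨⟨ht.1, ht.2.le.trans hc.2⟩, h⟩) (not_le.2 ht.2)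
  exact fun t ht => key t ht fun u hu => hall u ⟨hu.1, hu.2.le.trans ht.2⟩

section LimitSolutions

variable {X Y ι : Type*} [NormedAddCommGroup X] [ProperSpace X]
  [NormedAddCommGroup Y] [ProperSpace Y]

/-- Lipschitz continuity in `y` on balls at the parameter `x`, uniformly in time. -/
def LipschitzOnBalls (h : C(X × Y × ℝ, Y)) (x : X) : Prop :=
  ∀ R : ℝ, ∃ K : NNReal, ∀ t : ℝ, LipschitzOnWith K (fun y => h (x, y, t)) (closedBall 0 R)

theorem eventually_dist_field_le {l : Filter ι} {hj : ι → C(X × Y × ℝ, Y)}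
    {h : C(X × Y × ℝ, Y)} (hh : Tendsto hj l (𝓝 h)) {xj : ι → ℝ → X} {x : X}
    {a b : ℝ} {bj : ι → ℝ} (hb : ∀ j, bj j ≤ b)
    (hx : ∀ η > (0 : ℝ), ∀ᶠ j in l, ∀ t ∈ Icc a (bj j), dist (xj j t) x ≤ η)
    (R : ℝ) {η : ℝ} (hη : 0 < η) :
    ∀ᶠ j in l, ∀ t ∈ Icc a (bj j), ∀ w : Y, ‖w‖ ≤ R →
      dist (hj j (xj j t, w, t)) (h (x, w, t)) ≤ η := by
  set K : Set (X × Y × ℝ) := closedBall x 1 ×ˢ (closedBall 0 R ×ˢ Icc a b)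
  have hK : IsCompact K :=
    (isCompact_closedBall _ _).prod ((isCompact_closedBall _ _).prod isCompact_Icc)
  have h1 := ContinuousMap.tendsto_iff_forall_isCompact_tendstoUniformlyOn.1 hh K hK
  have h2 := Metric.tendstoUniformlyOn_iff.1 h1 (η / 2) (half_pos hη)
  have h3 := hK.uniformContinuousOn_of_continuous h.continuous.continuousOn
  obtain ⟨ρ, hρ, h4⟩ := Metric.uniformContinuousOn_iff.1 h3 (η / 2) (half_pos hη)
  filter_upwards [h2, hx (min 1 (ρ / 2)) (by positivity)] with j hj2 hjx t ht w hw
  have hxt := hjx t ht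
  have htb : t ∈ Icc a b := ⟨ht.1, ht.2.trans (hb j)⟩
  have hwR : w ∈ closedBall (0 : Y) R := by simpa using hw
  have m1 : (xj j t, w, t) ∈ K := ⟨hxt.trans (min_le_left _ _), hwR, htb⟩
  have m2 : (x, w, t) ∈ K := ⟨by simp, hwR, htb⟩
  have e1 := hj2 _ m1
  have e2 := h4 _ m1 _ m2 (by
    have := hxt.trans (min_le_right _ _)
    simp only [Prod.dist_eq, dist_self]
    exact max_lt (by linarith) hρ)
  rw [dist_comm] at e1
  linarith [dist_triangle (hj j (xj j t, w, t)) (h (xj j t, w, t)) (h (x, w, t))]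

variable [NormedSpace ℝ Y]

/-- Continuous dependence: solutions of converging equations with converging initial values
converge uniformly on compact intervals to the solution of the limit equation. -/
theorem eventually_dist_solution_le {l : Filter ι} {hj : ι → C(X × Y × ℝ, Y)}
    {h : C(X × Y × ℝ, Y)} (hh : Tendsto hj l (𝓝 h)) {xj : ι → ℝ → X} {x : X}
    (hlip : LipschitzOnBalls h x)
    {a b : ℝ} (hab : a ≤ b) {bj : ι → ℝ} (hb : ∀ j, bj j ≤ b)
    (hx : ∀ η > (0 : ℝ), ∀ᶠ j in l, ∀ t ∈ Icc a (bj j), dist (xj j t) x ≤ η)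
    {yj : ι → ℝ → Y} {z : ℝ → Y}
    (hy : ∀ᶠ j in l, ∀ t ∈ Icc a (bj j), HasDerivAt (yj j) (hj j (xj j t, yj j t, t)) t)
    (hz : ∀ t ∈ Icc a b, HasDerivAt z (h (x, z t, t)) t)
    (h0 : Tendsto (fun j => yj j a) l (𝓝 (z a))) {η : ℝ} (hη : 0 < η) :
    ∀ᶠ j in l, ∀ t ∈ Icc a (bj j), dist (yj j t) (z t) ≤ η := by
  have hcz : ContinuousOn z (Icc a b) := fun t ht => (hz t ht).continuousAt.continuousWithinAt
  obtain ⟨M, hM⟩ := isCompact_Icc.exists_bound_of_continuousOn hcz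
  obtain ⟨K, hK⟩ := hlip (M + 1)
  have hB := gronwallBound_one_pos K.2 (sub_nonneg.2 hab)
  set B := gronwallBound 1 (K : ℝ) 1 (b - a)
  set θ := min η (1 / 2) / B with hθ
  have hθ0 : 0 < θ := by positivity
  have hθB : θ * B = min η (1 / 2) := by rw [hθ]; exact div_mul_cancel₀ _ hB.ne'
  filter_upwards [hy, eventually_dist_field_le hh hb hx (M + 1) hθ0,
    Metric.tendsto_nhds.1 h0 θ hθ0] with j hyj hfj h0j t ht
  have hsub : ∀ u ∈ Icc a (bj j), u ∈ Icc a b := fun u hu => ⟨hu.1, hu.2.trans (hb j)⟩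
  have hBj : θ * gronwallBound 1 K 1 (bj j - a) ≤ min η (1 / 2) := by
    rw [← hθB]
    exact mul_le_mul_of_nonneg_left
      (gronwallBound_mono zero_le_one zero_le_one K.2 (by linarith [hb j])) hθ0.le
  refine (dist_le_of_approx_solution_s14 (G := fun t w => h (x, w, t)) (R := M + 1) (η := θ)
    (fun u _ => hK u) (fun u hu => hz u (hsub u hu))
    (fun u hu => by linarith [hM u (hsub u hu)]) hyj (fun u hu hR => hfj u hu _ hR) h0j.le
    (lt_of_le_of_lt hBj ?_) t ht).trans (hBj.trans (min_le_left _ _))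
  exact lt_of_le_of_lt (min_le_right _ _) (by norm_num)

/-- Forward uniqueness of solutions. -/
theorem solution_eqOn {h : C(X × Y × ℝ, Y)} {x : X} (hlip : LipschitzOnBalls h x) {a b : ℝ}
    {y z : ℝ → Y} (hy : ∀ t ∈ Icc a b, HasDerivAt y (h (x, y t, t)) t)
    (hz : ∀ t ∈ Icc a b, HasDerivAt z (h (x, z t, t)) t) (h0 : y a = z a) :
    EqOn y z (Icc a b) := by
  intro t ht
  refine dist_le_zero.1 (le_of_forall_pos_le_add fun η hη => ?_)
  have := eventually_dist_solution_le (ι := Unit) (l := ⊤) (hj := fun _ => h) tendsto_const_nhds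
    (xj := fun _ _ => x) hlip (ht.1.trans ht.2) (bj := fun _ => b) (fun _ => le_rfl)
    (fun η hη => by simp [hη.le]) (yj := fun _ => y) (by simpa using hy) hz
    (by simp [h0]) hη
  simpa using (by simpa using this : ∀ t, a ≤ t → t ≤ b → dist (y t) (z t) ≤ η) t ht.1 ht.2

end LimitSolutions

section Hull

variable {n m : ℕ}
  {g : C(EuclideanSpace ℝ (Fin n) × EuclideanSpace ℝ (Fin m) × ℝ, EuclideanSpace ℝ (Fin m))}
  {H : Type} {σf : ℝ → H → H}
  {ev : H → C(EuclideanSpace ℝ (Fin n) × EuclideanSpace ℝ (Fin m) × ℝ,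
    EuclideanSpace ℝ (Fin m))}
  {g0 : H}
  {sol : H → EuclideanSpace ℝ (Fin n) → ℝ → EuclideanSpace ℝ (Fin m) → ℝ →
    EuclideanSpace ℝ (Fin m)}

theorem lipschitzOnBalls_of_mem_closure (hlip : IsLipschitzInY g)
    {h : C(EuclideanSpace ℝ (Fin n) × EuclideanSpace ℝ (Fin m) × ℝ, EuclideanSpace ℝ (Fin m))}
    (hh : h ∈ closure {h | ∃ s : ℝ, h = timeTranslate s g}) (x : EuclideanSpace ℝ (Fin n)) :
    LipschitzOnBalls h x := by
  intro R
  obtain ⟨L, hL, hbd⟩ := hlip {x} isCompact_singleton _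
    (isCompact_closedBall (0 : EuclideanSpace ℝ (Fin m)) R)
  refine ⟨⟨L, hL.le⟩, fun t => LipschitzOnWith.of_dist_le_mul fun y hy z hz => ?_⟩
  have hclosed : IsClosed {h : C(EuclideanSpace ℝ (Fin n) × EuclideanSpace ℝ (Fin m) × ℝ,
      EuclideanSpace ℝ (Fin m)) | dist (h (x, y, t)) (h (x, z, t)) ≤ L * dist y z} :=
    isClosed_le (by fun_prop) continuous_const
  refine closure_minimal ?_ hclosed hh
  rintro _ ⟨s, rfl⟩
  simp only [mem_ofPred_eq, dist_eq_norm]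
  exact hbd x rfl y hy z hz (t + s)

theorem shift_solution_hasDerivAt
    (hequiv : ∀ (s : ℝ) (h : H), ev (σf s h) = timeTranslate s (ev h))
    {h : H} {x : EuclideanSpace ℝ (Fin n)} {y : ℝ → EuclideanSpace ℝ (Fin m)} {s τ : ℝ}
    (hy : HasDerivAt y (ev h (x, y (τ + s), τ + s)) (τ + s)) :
    HasDerivAt (fun u => y (u + s)) (ev (σf s h) (x, y (τ + s), τ)) τ := by
  rw [hequiv]
  exact hy.comp_add_const τ s

theorem norm_le_of_mem_attrFiber
    (hequiv : ∀ (s : ℝ) (h : H), ev (σf s h) = timeTranslate s (ev h))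
    (hsolinit : ∀ h x τ₀ y₀, sol h x τ₀ y₀ τ₀ = y₀)
    (hsolode : ∀ h x (τ₀ : ℝ) y₀ (τ : ℝ), τ₀ ≤ τ →
      HasDerivAt (sol h x τ₀ y₀) (ev h (x, sol h x τ₀ y₀ τ, τ)) τ)
    (hlip : ∀ h x, LipschitzOnBalls (ev h) x)
    {x : EuclideanSpace ℝ (Fin n)} {c : ℝ}
    (hbd : ∀ d > (0 : ℝ), ∃ T > (0 : ℝ), ∀ h : H, ∀ τ ≥ T, ∀ y₀ : EuclideanSpace ℝ (Fin m),
      ‖y₀‖ ≤ d → ‖sol h x 0 y₀ τ‖ ≤ c)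
    {h : H} {z : EuclideanSpace ℝ (Fin m)} (hz : z ∈ attrFiber ev h x) : ‖z‖ ≤ c := by
  obtain ⟨y, rfl, ⟨C, hC⟩, hy⟩ := hz
  obtain ⟨T, hT, hTb⟩ := hbd (max C 1) (by positivity)
  have := solution_eqOn (hlip (σf (-T) h) x) (a := 0) (b := T) (y := fun u => y (u + -T))
    (z := sol (σf (-T) h) x 0 (y (-T)))
    (fun t _ => shift_solution_hasDerivAt hequiv (hy _))
    (fun t ht => hsolode _ _ _ _ _ ht.1) (by simp [hsolinit]) ⟨hT.le, le_rfl⟩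
  simp only [add_neg_cancel] at this
  rw [this]
  exact hTb _ T le_rfl _ ((hC _).trans (le_max_left _ _))

variable [MetricSpace H]

theorem dense_orbit (hev : Topology.IsEmbedding ev)
    (hrange : Set.range ev = closure {h | ∃ s : ℝ, h = timeTranslate s g})
    (hg0 : ev g0 = g)
    (hequiv : ∀ (s : ℝ) (h : H), ev (σf s h) = timeTranslate s (ev h)) :
    Dense (Set.range fun s => σf s g0) := by
  intro h
  rw [hev.closure_eq_preimage_closure_image, mem_preimage]
  have : ev '' (Set.range fun s => σf s g0) = {h | ∃ s : ℝ, h = timeTranslate s g} := by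
    ext k
    simp [hequiv, hg0, eq_comm]
  rw [this, ← hrange]
  exact mem_range_self h

theorem continuous_solution_hull (hev : Continuous ev)
    (hsolinit : ∀ h x τ₀ y₀, sol h x τ₀ y₀ τ₀ = y₀)
    (hsolode : ∀ h x (τ₀ : ℝ) y₀ (τ : ℝ), τ₀ ≤ τ →
      HasDerivAt (sol h x τ₀ y₀) (ev h (x, sol h x τ₀ y₀ τ, τ)) τ)
    (hlip : ∀ h x, LipschitzOnBalls (ev h) x)
    (x : EuclideanSpace ℝ (Fin n)) (y₀ : EuclideanSpace ℝ (Fin m)) {τ : ℝ} (hτ : 0 ≤ τ) :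
    Continuous fun h => sol h x 0 y₀ τ := by
  refine continuous_iff_continuousAt.2 fun h => Metric.tendsto_nhds.2 fun η hη => ?_
  filter_upwards [eventually_dist_solution_le (hev.tendsto h) (xj := fun _ _ => x) (hlip h x) hτ
    (bj := fun _ => τ) (fun _ => le_rfl) (fun η hη => by simp [hη.le])
    (yj := fun h => sol h x 0 y₀) (Eventually.of_forall fun h' t ht => hsolode h' x 0 y₀ t ht.1)
    (fun t ht => hsolode h x 0 y₀ t ht.1) (by simp [hsolinit]) (half_pos hη)] with h' hh'
  linarith [hh' τ ⟨hτ, le_rfl⟩]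

/-- Ultimate bounds for the solutions driven by `g0` pass to the whole hull. -/
theorem hull_ultimate_bound (hev : Topology.IsEmbedding ev)
    (hrange : Set.range ev = closure {h | ∃ s : ℝ, h = timeTranslate s g})
    (hg0 : ev g0 = g)
    (hequiv : ∀ (s : ℝ) (h : H), ev (σf s h) = timeTranslate s (ev h))
    (hsolinit : ∀ h x τ₀ y₀, sol h x τ₀ y₀ τ₀ = y₀)
    (hsolode : ∀ h x (τ₀ : ℝ) y₀ (τ : ℝ), τ₀ ≤ τ →
      HasDerivAt (sol h x τ₀ y₀) (ev h (x, sol h x τ₀ y₀ τ, τ)) τ)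
    (hlip : ∀ h x, LipschitzOnBalls (ev h) x)
    {x : EuclideanSpace ℝ (Fin n)} {y₀ : EuclideanSpace ℝ (Fin m)} {c τ : ℝ} (hτ : 0 ≤ τ)
    (hbd : ∀ τ₀ : ℝ, ‖sol g0 x τ₀ y₀ (τ + τ₀)‖ ≤ c) (h : H) :
    ‖sol h x 0 y₀ τ‖ ≤ c := by
  have hclosed : IsClosed {h | ‖sol h x 0 y₀ τ‖ ≤ c} :=
    isClosed_le (continuous_solution_hull hev.continuous hsolinit hsolode hlip x y₀ hτ).norm
      continuous_const
  refine closure_minimal ?_ hclosed (dense_orbit hev hrange hg0 hequiv h)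
  rintro _ ⟨s, rfl⟩
  have := solution_eqOn (hlip (σf s g0) x) (a := 0) (b := τ) (y := sol (σf s g0) x 0 y₀)
    (z := fun u => sol g0 x s y₀ (u + s)) (fun t ht => hsolode _ _ _ _ _ ht.1)
    (fun t ht => shift_solution_hasDerivAt hequiv (hsolode _ _ _ _ _ (by linarith [ht.1])))
    (by simp [hsolinit]) ⟨hτ, le_rfl⟩
  simp only [mem_ofPred_eq, this]
  exact hbd s

end Hull

section SlowFast

variable {n m : ℕ}
  {g : C(EuclideanSpace ℝ (Fin n) × EuclideanSpace ℝ (Fin m) × ℝ, EuclideanSpace ℝ (Fin m))}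
  {H : Type} [MetricSpace H] {σf : ℝ → H → H}
  {ev : H → C(EuclideanSpace ℝ (Fin n) × EuclideanSpace ℝ (Fin m) × ℝ,
    EuclideanSpace ℝ (Fin m))}
  {g0 : H}
  {sol : H → EuclideanSpace ℝ (Fin n) → ℝ → EuclideanSpace ℝ (Fin m) → ℝ →
    EuclideanSpace ℝ (Fin m)}
  {t₀ : ℝ} {ε : ℕ → ℝ} {xe : ℕ → ℝ → EuclideanSpace ℝ (Fin n)}
  {ye : ℕ → ℝ → EuclideanSpace ℝ (Fin m)} {x0 : ℝ → EuclideanSpace ℝ (Fin n)}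

/-- Near converging slow times the slow component is nearly constant on bounded windows. -/
theorem eventually_dist_slow_le
    (hεpos : ∀ k, 0 < ε k) (hεlim : Tendsto ε atTop (𝓝 0))
    (hx0cont : ContinuousOn x0 (Set.Icc 0 t₀))
    (hconv : TendstoUniformlyOn (fun k t => xe k (t / ε k)) x0 atTop (Set.Icc 0 t₀))
    {ι : Type*} {l : Filter ι} {k : ι → ℕ} (hk : Tendsto k l atTop) {τ : ι → ℝ}
    (hτ : ∀ᶠ j in l, 0 ≤ τ j) {t : ℝ} (htI : t ∈ Icc 0 t₀)
    (ht : Tendsto (fun j => ε (k j) * τ j) l (𝓝 t)) (S : ℝ) {η : ℝ} (hη : 0 < η) :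
    ∀ᶠ j in l, ∀ s ∈ Icc 0 (min S (t₀ / ε (k j) - τ j)),
      dist (xe (k j) (s + τ j)) (x0 t) ≤ η := by
  obtain ⟨ρ, hρ, hx0⟩ := Metric.continuousWithinAt_iff.1 (hx0cont t htI) (η / 2) (half_pos hη)
  have h1 := hk.eventually (Metric.tendstoUniformlyOn_iff.1 hconv (η / 2) (half_pos hη))
  have h2 : Tendsto (fun j => ε (k j) * S) l (𝓝 0) := by
    simpa using (hεlim.comp hk).mul_const S
  filter_upwards [h1, hτ, Metric.tendsto_nhds.1 ht (ρ / 2) (half_pos hρ),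
    Metric.tendsto_nhds.1 h2 (ρ / 2) (half_pos hρ)] with j hj1 hjτ hjt hjS s hs
  have hε := hεpos (k j)
  have hsS : s ≤ S := hs.2.trans (min_le_left _ _)
  have hsT : s + τ j ≤ t₀ / ε (k j) := by linarith [hs.2.trans (min_le_right _ _)]
  have hmem : ε (k j) * (s + τ j) ∈ Icc 0 t₀ := by
    refine ⟨mul_nonneg hε.le (by linarith [hs.1]), ?_⟩
    rw [le_div_iff₀ hε] at hsT
    linarith
  have e1 := hj1 _ hmem
  rw [mul_div_cancel_left₀ _ hε.ne', dist_comm] at e1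
  have e2 : dist (x0 (ε (k j) * (s + τ j))) (x0 t) < η / 2 := by
    refine hx0 hmem ?_
    rw [Real.dist_eq, abs_lt] at hjt hjS ⊢
    have := mul_le_mul_of_nonneg_left hsS hε.le
    have := mul_nonneg hε.le hs.1
    constructor <;> nlinarith
  linarith [dist_triangle (xe (k j) (s + τ j)) (x0 (ε (k j) * (s + τ j))) (x0 t)]

/-- On bounded windows the fast component tracks the equation with frozen slow variable. -/
theorem eventually_dist_fast_le
    (hev : Continuous ev) (hg0 : ev g0 = g)
    (hequiv : ∀ (s : ℝ) (h : H), ev (σf s h) = timeTranslate s (ev h))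
    (hsolinit : ∀ h x τ₀ y₀, sol h x τ₀ y₀ τ₀ = y₀)
    (hsolode : ∀ h x (τ₀ : ℝ) y₀ (τ : ℝ), τ₀ ≤ τ →
      HasDerivAt (sol h x τ₀ y₀) (ev h (x, sol h x τ₀ y₀ τ, τ)) τ)
    (hlip : ∀ h x, LipschitzOnBalls (ev h) x)
    (hεpos : ∀ k, 0 < ε k) (hεlim : Tendsto ε atTop (𝓝 0))
    (hyeode : ∀ k : ℕ, ∀ τ ∈ Set.Icc (0:ℝ) (t₀ / ε k),
      HasDerivAt (ye k) (g (xe k τ, ye k τ, τ)) τ)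
    (hx0cont : ContinuousOn x0 (Set.Icc 0 t₀))
    (hconv : TendstoUniformlyOn (fun k t => xe k (t / ε k)) x0 atTop (Set.Icc 0 t₀))
    {ι : Type*} {l : Filter ι} {k : ι → ℕ} (hk : Tendsto k l atTop) {τ : ι → ℝ}
    (hτ : ∀ᶠ j in l, 0 ≤ τ j) {t : ℝ} (htI : t ∈ Icc 0 t₀)
    (ht : Tendsto (fun j => ε (k j) * τ j) l (𝓝 t))
    {h : H} (hh : Tendsto (fun j => σf (τ j) g0) l (𝓝 h))
    {p : EuclideanSpace ℝ (Fin m)} (hp : Tendsto (fun j => ye (k j) (τ j)) l (𝓝 p))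
    {S : ℝ} (hS : 0 ≤ S) {η : ℝ} (hη : 0 < η) :
    ∀ᶠ j in l, ∀ s ∈ Icc 0 S, s + τ j ≤ t₀ / ε (k j) →
      dist (ye (k j) (s + τ j)) (sol h (x0 t) 0 p s) ≤ η := by
  have key := eventually_dist_solution_le (a := 0) (b := S)
    (bj := fun j => min S (t₀ / ε (k j) - τ j))
    (xj := fun j s => xe (k j) (s + τ j)) (yj := fun j s => ye (k j) (s + τ j))
    ((hev.tendsto h).comp hh) (hlip h (x0 t)) hS (fun j => min_le_left _ _)
    (fun η hη => eventually_dist_slow_le hεpos hεlim hx0cont hconv hk hτ htI ht S hη)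
    (z := sol h (x0 t) 0 p)
    (by
      filter_upwards [hτ] with j hj s hs
      refine shift_solution_hasDerivAt hequiv ?_
      rw [hg0]
      exact hyeode (k j) _ ⟨by linarith [hs.1], by linarith [hs.2.trans (min_le_right _ _)]⟩)
    (fun s hs => hsolode _ _ _ _ _ hs.1) (by simpa [hsolinit] using hp) hη
  filter_upwards [key] with j hj s hs hsT
  exact hj s ⟨hs.1, le_min hs.2 (by linarith)⟩

theorem exists_mem_tendsto_of_isCompact {ι E : Type*} [TopologicalSpace E] (U : Ultrafilter ι)
    {K : Set E} (hK : IsCompact K) {u : ι → E} (hu : ∀ᶠ j in U, u j ∈ K) :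
    ∃ p ∈ K, Tendsto u U (𝓝 p) :=
  isCompact_iff_ultrafilter_le_nhds'.1 hK (U.map u) hu

/-- Limits of the fast component at times tending to infinity lie in the limiting fiber. -/
theorem exists_mem_attrFiber_tendsto
    (hσcont : Continuous fun p : ℝ × H => σf p.1 p.2)
    (hσ0 : ∀ h, σf 0 h = h)
    (hσadd : ∀ s t : ℝ, ∀ h, σf (s + t) h = σf s (σf t h))
    (hev : Continuous ev) (hg0 : ev g0 = g)
    (hequiv : ∀ (s : ℝ) (h : H), ev (σf s h) = timeTranslate s (ev h))
    (hsolinit : ∀ h x τ₀ y₀, sol h x τ₀ y₀ τ₀ = y₀)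
    (hsolode : ∀ h x (τ₀ : ℝ) y₀ (τ : ℝ), τ₀ ≤ τ →
      HasDerivAt (sol h x τ₀ y₀) (ev h (x, sol h x τ₀ y₀ τ, τ)) τ)
    (hlip : ∀ h x, LipschitzOnBalls (ev h) x)
    (hεpos : ∀ k, 0 < ε k) (hεlim : Tendsto ε atTop (𝓝 0))
    (hyeode : ∀ k : ℕ, ∀ τ ∈ Set.Icc (0:ℝ) (t₀ / ε k),
      HasDerivAt (ye k) (g (xe k τ, ye k τ, τ)) τ)
    (hx0cont : ContinuousOn x0 (Set.Icc 0 t₀))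
    (hconv : TendstoUniformlyOn (fun k t => xe k (t / ε k)) x0 atTop (Set.Icc 0 t₀))
    {ι : Type*} {U : Ultrafilter ι} {k : ι → ℕ} (hk : Tendsto k U atTop) {τ : ι → ℝ}
    (hτ : Tendsto τ U atTop) (hτle : ∀ᶠ j in U, τ j ≤ t₀ / ε (k j))
    {t : ℝ} (htI : t ∈ Icc 0 t₀)
    (ht : Tendsto (fun j => ε (k j) * τ j) U (𝓝 t))
    {h : H} (hh : Tendsto (fun j => σf (τ j) g0) U (𝓝 h))
    {R : ℝ} (hR : ∀ᶠ j in U, ∀ s ∈ Icc 0 (t₀ / ε (k j)), ‖ye (k j) s‖ ≤ R)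
    {c T : ℝ} (hbd : ∀ h : H, ∀ τ ≥ T, ∀ y₀ : EuclideanSpace ℝ (Fin m),
      ‖y₀‖ ≤ R → ‖sol h (x0 t) 0 y₀ τ‖ ≤ c) :
    ∃ z ∈ attrFiber ev h (x0 t), Tendsto (fun j => ye (k j) (τ j)) U (𝓝 z) := by
  have hback : ∀ N : ℕ, ∀ᶠ j in U, 0 ≤ τ j - N := fun N => by
    filter_upwards [hτ.eventually_ge_atTop (N : ℝ)] with j hj
    linarith
  have hpast : ∀ N : ℕ, ∃ p : EuclideanSpace ℝ (Fin m), ‖p‖ ≤ R ∧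
      Tendsto (fun j => ye (k j) (τ j - N)) U (𝓝 p) := fun N => by
    obtain ⟨p, hp, hlim⟩ := exists_mem_tendsto_of_isCompact U
      (isCompact_closedBall (0 : EuclideanSpace ℝ (Fin m)) R)
      (u := fun j => ye (k j) (τ j - N)) (by
        filter_upwards [hback N, hR, hτle] with j hj hjR hjτ
        rw [mem_closedBall_zero_iff]
        exact hjR _ ⟨hj, by linarith [Nat.cast_nonneg (α := ℝ) N]⟩)
    exact ⟨p, mem_closedBall_zero_iff.1 hp, hlim⟩
  choose p hpR hp using hpast
  have hlim : ∀ N : ℕ, ∀ s : ℝ, 0 ≤ s → s ≤ N → Tendsto (fun j => ye (k j) (s + (τ j - N))) U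
      (𝓝 (sol (σf (-N) h) (x0 t) 0 (p N) s)) := by
    intro N s hs hsN
    refine Metric.tendsto_nhds.2 fun η hη => ?_
    have htN : Tendsto (fun j => ε (k j) * (τ j - N)) U (𝓝 t) := by
      simpa [mul_sub] using ht.sub ((hεlim.comp hk).mul_const (N : ℝ))
    have hhN : Tendsto (fun j => σf (τ j - N) g0) U (𝓝 (σf (-N) h)) := by
      have hc : Continuous fun h => σf (-N) h := hσcont.comp (continuous_const.prodMk continuous_id)
      refine ((hc.tendsto h).comp hh).congr fun j => ?_
      rw [Function.comp_apply, ← hσadd, neg_add_eq_sub]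
    filter_upwards [eventually_dist_fast_le hev hg0 hequiv hsolinit hsolode hlip hεpos hεlim
      hyeode hx0cont hconv hk (hback N) htI htN hhN (hp N) hs (half_pos hη), hτle] with j hj hjτ
    linarith [hj s ⟨hs, le_rfl⟩ (by linarith)]
  set z : ℕ → ℝ → EuclideanSpace ℝ (Fin m) :=
    fun N s => sol (σf (-N) h) (x0 t) 0 (p N) (s + N) with hz
  have hzode : ∀ N : ℕ, ∀ s : ℝ, -N ≤ s → HasDerivAt (z N) (ev h (x0 t, z N s, s)) s := by
    intro N s hs
    have := shift_solution_hasDerivAt hequiv (s := (N : ℝ)) (τ := s)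
      (hsolode (σf (-N) h) (x0 t) 0 (p N) (s + N) (by linarith))
    rwa [← hσadd, add_neg_cancel, hσ0] at this
  have hzz : ∀ N M : ℕ, N ≤ M → ∀ s : ℝ, -N ≤ s → z N s = z M s := by
    intro N M hNM s hs
    have hNM' : (N : ℝ) ≤ M := by exact_mod_cast hNM
    refine solution_eqOn (hlip h (x0 t)) (a := -N) (b := s) (fun u hu => hzode N u hu.1)
      (fun u hu => hzode M u (by linarith [hu.1])) ?_ ⟨hs, le_rfl⟩
    have h1 := hlim M (-N + M) (by linarith) (by linarith [Nat.cast_nonneg (α := ℝ) N])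
    have h2 : (fun j => ye (k j) (-N + M + (τ j - M))) = fun j => ye (k j) (τ j - N) := by
      funext j
      congr 1
      ring
    rw [h2] at h1
    simp only [hz, neg_add_cancel, hsolinit]
    exact tendsto_nhds_unique (hp N) h1
  set w : ℝ → EuclideanSpace ℝ (Fin m) := fun s => z ⌈|s|⌉₊ s with hw
  have hwz : ∀ N : ℕ, ∀ s : ℝ, -N ≤ s → w s = z N s := by
    intro N s hs
    have hs' : -(⌈|s|⌉₊ : ℝ) ≤ s := by linarith [neg_abs_le s, Nat.le_ceil |s|]
    rw [hw, hzz N _ (le_max_left N ⌈|s|⌉₊) s hs]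
    exact hzz _ _ (le_max_right N ⌈|s|⌉₊) s hs'
  refine ⟨p 0, ⟨w, ?_, ⟨c, fun s => ?_⟩, fun s => ?_⟩, by simpa using hp 0⟩
  · rw [hwz 0 0 (by simp)]
    simp [hz, hsolinit]
  · obtain ⟨N, hN⟩ := exists_nat_ge (max (-s) (T - s))
    rw [hwz N s (by linarith [(le_max_left _ _).trans hN])]
    exact hbd _ _ (by linarith [(le_max_right _ _).trans hN]) _ (hpR N)
  · obtain ⟨N, hN⟩ := exists_nat_gt (-s)
    have hsN : -(N : ℝ) < s := by linarith
    rw [hwz N s hsN.le]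
    refine (hzode N s hsN.le).congr_of_eventuallyEq ?_
    filter_upwards [Ioi_mem_nhds hsN] with u hu
    exact hwz N u (le_of_lt hu)

variable [CompactSpace H]

theorem exists_bound_fast_window
    (hev : Continuous ev) (hg0 : ev g0 = g)
    (hequiv : ∀ (s : ℝ) (h : H), ev (σf s h) = timeTranslate s (ev h))
    (hsolinit : ∀ h x τ₀ y₀, sol h x τ₀ y₀ τ₀ = y₀)
    (hsolode : ∀ h x (τ₀ : ℝ) y₀ (τ : ℝ), τ₀ ≤ τ →
      HasDerivAt (sol h x τ₀ y₀) (ev h (x, sol h x τ₀ y₀ τ, τ)) τ)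
    (hlip : ∀ h x, LipschitzOnBalls (ev h) x)
    (hεpos : ∀ k, 0 < ε k) (hεlim : Tendsto ε atTop (𝓝 0))
    (hyeode : ∀ k : ℕ, ∀ τ ∈ Set.Icc (0:ℝ) (t₀ / ε k),
      HasDerivAt (ye k) (g (xe k τ, ye k τ, τ)) τ)
    (hx0cont : ContinuousOn x0 (Set.Icc 0 t₀))
    (hconv : TendstoUniformlyOn (fun k t => xe k (t / ε k)) x0 atTop (Set.Icc 0 t₀))
    {c d T : ℝ} (hT : 0 < T)
    (hbd : ∀ h : H, ∀ t ∈ Icc 0 t₀, ∀ y₀ : EuclideanSpace ℝ (Fin m),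
      ‖y₀‖ ≤ d → ‖sol h (x0 t) 0 y₀ T‖ ≤ c) :
    ∃ R : ℝ, ∃ k₀ : ℕ, ∀ k ≥ k₀, ∀ τ ≥ (0 : ℝ), ‖ye k τ‖ ≤ d → ∀ s ∈ Icc 0 T,
      s + τ ≤ t₀ / ε k → ‖ye k (s + τ)‖ ≤ R ∧ (s = T → ‖ye k (s + τ)‖ ≤ c + 1) := by
  by_contra! hcon
  choose k hkge τ hτ hd s hs hsτ hbad using fun j : ℕ => hcon j j
  set U : Ultrafilter ℕ := hyperfilter ℕ
  have hU : (U : Filter ℕ) ≤ atTop := Nat.hyperfilter_le_atTop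
  have hk : Tendsto k U atTop := (tendsto_atTop_mono hkge tendsto_id).mono_left hU
  obtain ⟨h, -, hh⟩ := exists_mem_tendsto_of_isCompact U (isCompact_univ (X := H))
    (u := fun j => σf (τ j) g0) (by simp)
  obtain ⟨p, hp, hplim⟩ := exists_mem_tendsto_of_isCompact U
    (isCompact_closedBall (0 : EuclideanSpace ℝ (Fin m)) d) (u := fun j => ye (k j) (τ j))
    (Eventually.of_forall fun j => mem_closedBall_zero_iff.2 (hd j))
  obtain ⟨t, htI, ht⟩ := exists_mem_tendsto_of_isCompact U
    (isCompact_Icc (a := (0 : ℝ)) (b := t₀)) (u := fun j => ε (k j) * τ j)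
    (Eventually.of_forall fun j => by
      have hε := hεpos (k j)
      refine ⟨mul_nonneg hε.le (hτ j), ?_⟩
      have : τ j ≤ t₀ / ε (k j) := by linarith [hsτ j, (hs j).1]
      rw [le_div_iff₀ hε] at this
      linarith)
  have hcz : ContinuousOn (sol h (x0 t) 0 p) (Icc 0 T) :=
    fun u hu => (hsolode _ _ _ _ _ hu.1).continuousAt.continuousWithinAt
  obtain ⟨M, hM⟩ := isCompact_Icc.exists_bound_of_continuousOn hcz
  obtain ⟨j, hj, hjM⟩ := ((eventually_dist_fast_le hev hg0 hequiv hsolinit hsolode hlip hεpos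
    hεlim hyeode hx0cont hconv hk (Eventually.of_forall hτ) htI ht hh hplim hT.le one_pos).and
    ((tendsto_natCast_atTop_atTop (R := ℝ)).mono_left hU |>.eventually_ge_atTop (M + 1))).exists
  have e := hj _ (hs j) (hsτ j)
  rw [dist_eq_norm] at e
  have e' := norm_sub_norm_le (ye (k j) (s j + τ j)) (sol h (x0 t) 0 p (s j))
  obtain ⟨hsT, hlt⟩ := hbad j (by linarith [hM _ (hs j)])
  have := hbd h t htI p (mem_closedBall_zero_iff.1 hp)
  rw [hsT] at e e' hlt
  linarith

/-- The fast components are bounded uniformly in `k`. -/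
theorem exists_bound_fast
    (hev : Continuous ev) (hg0 : ev g0 = g)
    (hequiv : ∀ (s : ℝ) (h : H), ev (σf s h) = timeTranslate s (ev h))
    (hsolinit : ∀ h x τ₀ y₀, sol h x τ₀ y₀ τ₀ = y₀)
    (hsolode : ∀ h x (τ₀ : ℝ) y₀ (τ : ℝ), τ₀ ≤ τ →
      HasDerivAt (sol h x τ₀ y₀) (ev h (x, sol h x τ₀ y₀ τ, τ)) τ)
    (hlip : ∀ h x, LipschitzOnBalls (ev h) x)
    (hεpos : ∀ k, 0 < ε k) (hεlim : Tendsto ε atTop (𝓝 0))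
    (hyeode : ∀ k : ℕ, ∀ τ ∈ Set.Icc (0:ℝ) (t₀ / ε k),
      HasDerivAt (ye k) (g (xe k τ, ye k τ, τ)) τ)
    {yInit : EuclideanSpace ℝ (Fin m)} (hye0 : ∀ k, ye k 0 = yInit)
    (hx0cont : ContinuousOn x0 (Set.Icc 0 t₀))
    (hconv : TendstoUniformlyOn (fun k t => xe k (t / ε k)) x0 atTop (Set.Icc 0 t₀))
    {c : ℝ} (hbd : ∀ d > (0 : ℝ), ∃ T > (0 : ℝ), ∀ h : H, ∀ t ∈ Icc 0 t₀, ∀ τ ≥ T,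
      ∀ y₀ : EuclideanSpace ℝ (Fin m), ‖y₀‖ ≤ d → ‖sol h (x0 t) 0 y₀ τ‖ ≤ c) :
    ∃ R : ℝ, ∃ k₀ : ℕ, ∀ k ≥ k₀, ∀ s ∈ Icc 0 (t₀ / ε k), ‖ye k s‖ ≤ R := by
  set d := max (max (c + 1) ‖yInit‖) 1
  obtain ⟨T, hT, hTb⟩ := hbd d (by positivity)
  obtain ⟨R, k₀, hR⟩ := exists_bound_fast_window hev hg0 hequiv hsolinit hsolode hlip hεpos
    hεlim hyeode hx0cont hconv hT (fun h t ht y₀ hy => hTb h t ht T le_rfl y₀ hy)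
  refine ⟨R, k₀, fun k hk s hs => ?_⟩
  have hstep : ∀ N : ℕ, N * T ≤ t₀ / ε k → ‖ye k (N * T)‖ ≤ d := by
    intro N
    induction N with
    | zero =>
      intro _
      rw [Nat.cast_zero, zero_mul, hye0]
      exact (le_max_right _ _).trans (le_max_left _ _)
    | succ N ih =>
      intro hN
      have e : ((N + 1 : ℕ) : ℝ) * T = T + N * T := by
        push_cast
        ring
      rw [e] at hN ⊢
      exact ((hR k hk _ (by positivity) (ih (by linarith)) T ⟨hT.le, le_rfl⟩ hN).2 rfl).trans
        ((le_max_left _ _).trans (le_max_left _ _))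
  have h1 : ⌊s / T⌋₊ * T ≤ s := (le_div_iff₀ hT).1 (Nat.floor_le (div_nonneg hs.1 hT.le))
  have h2 : s < (⌊s / T⌋₊ + 1) * T := (div_lt_iff₀ hT).1 (Nat.lt_floor_add_one _)
  have := (hR k hk (⌊s / T⌋₊ * T) (by positivity) (hstep _ (h1.trans hs.2))
    (s - ⌊s / T⌋₊ * T) ⟨by linarith, by linarith⟩ (by linarith [hs.2])).1
  rwa [sub_add_cancel] at this

end SlowFast

/-- under continuity of (h,x) ↦ A_{(h,x)}, the fast motion tracks the (non-inflated) fibers of the pullback attractor. -/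
theorem stmt_14
    {n m : ℕ} (hn : 1 ≤ n) (hm : 1 ≤ m)
    -- g, admissible and Lipschitz in y on compacts
    (g : C(EuclideanSpace ℝ (Fin n) × EuclideanSpace ℝ (Fin m) × ℝ,
      EuclideanSpace ℝ (Fin m)))
    (hadm : IsAdmissibleMap g) (hlip : IsLipschitzInY g)
    -- the hull H of g, a compact metric space with the continuous shift flow,
    -- identified via the embedding ev with the closure of the translates of g
    (H : Type) [MetricSpace H] [CompactSpace H]
    (σf : ℝ → H → H)
    (hσcont : Continuous fun p : ℝ × H => σf p.1 p.2)
    (hσ0 : ∀ h, σf 0 h = h)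
    (hσadd : ∀ s t : ℝ, ∀ h, σf (s + t) h = σf s (σf t h))
    (ev : H → C(EuclideanSpace ℝ (Fin n) × EuclideanSpace ℝ (Fin m) × ℝ,
      EuclideanSpace ℝ (Fin m)))
    (hev : Topology.IsEmbedding ev)
    (hrange : Set.range ev = closure {h | ∃ s : ℝ, h = timeTranslate s g})
    (g0 : H) (hg0 : ev g0 = g)
    (hequiv : ∀ (s : ℝ) (h : H), ev (σf s h) = timeTranslate s (ev h))
    -- the (unique, maximal) solutions y(τ,h,x,τ₀,y₀) of y' = h(x,y,τ)
    (sol : H → EuclideanSpace ℝ (Fin n) → ℝ → EuclideanSpace ℝ (Fin m) → ℝ →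
      EuclideanSpace ℝ (Fin m))
    (hsolinit : ∀ h x τ₀ y₀, sol h x τ₀ y₀ τ₀ = y₀)
    -- (H1): all solutions over the hull are globally defined in the future
    (hsolode : ∀ h x (τ₀ : ℝ) y₀ (τ : ℝ), τ₀ ≤ τ →
      HasDerivAt (sol h x τ₀ y₀) (ev h (x, sol h x τ₀ y₀ τ, τ)) τ)
    -- (H2): uniform ultimate boundedness over compact sets of parameters
    (hH2 : ∀ K₀ : Set (EuclideanSpace ℝ (Fin n)), IsCompact K₀ →
      ∃ c > (0:ℝ), ∀ d > (0:ℝ), ∃ T > (0:ℝ), ∀ x ∈ K₀, ∀ τ₀ : ℝ, ∀ τ ≥ T,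
        ∀ y₀ : EuclideanSpace ℝ (Fin m), ‖y₀‖ ≤ d → ‖sol g0 x τ₀ y₀ (τ + τ₀)‖ ≤ c)
    -- the slow vector field f, continuous and of linear growth
    (f : EuclideanSpace ℝ (Fin n) → EuclideanSpace ℝ (Fin m) → EuclideanSpace ℝ (Fin n))
    (hf : Continuous fun p : EuclideanSpace ℝ (Fin n) × EuclideanSpace ℝ (Fin m) =>
      f p.1 p.2)
    (a b : ℝ) (ha : 0 < a) (hb : 0 < b)
    (hgrowth : ∀ x y, ‖f x y‖ ≤ a + b * ‖x‖)
    -- initial data, final slow time, the sequence ε_k ↓ 0, and the solutions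
    -- (x_{ε_k}, y_{ε_k}) of the slow-fast system in the fast time
    (xInit : EuclideanSpace ℝ (Fin n)) (yInit : EuclideanSpace ℝ (Fin m))
    (t₀ : ℝ) (ht₀ : 0 < t₀)
    (ε : ℕ → ℝ) (hεpos : ∀ k, 0 < ε k) (hεanti : StrictAnti ε)
    (hεlim : Tendsto ε atTop (𝓝 0))
    (xe : ℕ → ℝ → EuclideanSpace ℝ (Fin n)) (ye : ℕ → ℝ → EuclideanSpace ℝ (Fin m))
    (hxe0 : ∀ k, xe k 0 = xInit) (hye0 : ∀ k, ye k 0 = yInit)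
    (hxeode : ∀ k : ℕ, ∀ τ ∈ Set.Icc (0:ℝ) (t₀ / ε k),
      HasDerivAt (xe k) (ε k • f (xe k τ) (ye k τ)) τ)
    (hyeode : ∀ k : ℕ, ∀ τ ∈ Set.Icc (0:ℝ) (t₀ / ε k),
      HasDerivAt (ye k) (g (xe k τ, ye k τ, τ)) τ)
    -- the slow components converge uniformly (in the slow time) to x₀
    (x0 : ℝ → EuclideanSpace ℝ (Fin n)) (hx0cont : ContinuousOn x0 (Set.Icc 0 t₀))
    (hconv : TendstoUniformlyOn (fun k t => xe k (t / ε k)) x0 atTop (Set.Icc 0 t₀))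
    -- the radius of the compact tube K₀ around x₀
    (r : ℝ) (hr : 0 < r)
    -- continuity of (h,x) ↦ A_{(h,x)} for the Hausdorff distance
    (hcont : ∀ p : H × EuclideanSpace ℝ (Fin n), p.2 ∈ slowTube x0 t₀ r →
      Tendsto (fun q : H × EuclideanSpace ℝ (Fin n) =>
          Metric.hausdorffDist (attrFiber ev q.1 q.2) (attrFiber ev p.1 p.2))
        (𝓝[{q : H × EuclideanSpace ℝ (Fin n) | q.2 ∈ slowTube x0 t₀ r}] p) (𝓝 0))
    (δ : ℝ) (hδ : 0 < δ) :
    ∃ T > (0:ℝ), ∃ k₀ : ℕ, 2 * T < t₀ / ε k₀ ∧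
      ∀ k ≥ k₀, ∀ τ ∈ Set.Icc T (t₀ / ε k),
        Metric.infDist (ye k τ) (attrFiber ev (σf τ g0) (x0 (ε k * τ))) ≤ δ := by
  obtain ⟨c, hc, hcb⟩ := hH2 (x0 '' Icc 0 t₀) (isCompact_Icc.image_of_continuousOn hx0cont)
  have hlipH : ∀ h x, LipschitzOnBalls (ev h) x := fun h x =>
    lipschitzOnBalls_of_mem_closure hlip (hrange ▸ mem_range_self h) x
  have hbd : ∀ d > (0 : ℝ), ∃ T > (0 : ℝ), ∀ h : H, ∀ t ∈ Icc 0 t₀, ∀ τ ≥ T,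
      ∀ y₀ : EuclideanSpace ℝ (Fin m), ‖y₀‖ ≤ d → ‖sol h (x0 t) 0 y₀ τ‖ ≤ c := by
    intro d hd
    obtain ⟨T, hT, hTb⟩ := hcb d hd
    exact ⟨T, hT, fun h t ht τ hτ y₀ hy => hull_ultimate_bound hev hrange hg0 hequiv hsolinit
      hsolode hlipH (hT.le.trans hτ)
      (fun τ₀ => hTb _ (mem_image_of_mem x0 ht) τ₀ τ hτ y₀ hy) h⟩
  have hfib : ∀ h : H, ∀ t ∈ Icc 0 t₀, Bornology.IsBounded (attrFiber ev h (x0 t)) := by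
    intro h t ht
    refine isBounded_closedBall.subset fun z hz => mem_closedBall_zero_iff.2
      (norm_le_of_mem_attrFiber hequiv hsolinit hsolode hlipH (x := x0 t) (c := c) ?_ hz)
    intro d hd
    obtain ⟨T, hT, hTb⟩ := hbd d hd
    exact ⟨T, hT, fun h => hTb h t ht⟩
  obtain ⟨R, k₁, hR⟩ := exists_bound_fast hev.continuous hg0 hequiv hsolinit hsolode hlipH hεpos
    hεlim hyeode hye0 hx0cont hconv hbd
  obtain ⟨T, -, hTb⟩ := hbd (max R 1) (by positivity)
  have htube : ∀ t ∈ Icc 0 t₀, x0 t ∈ slowTube x0 t₀ r :=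
    fun t ht => ⟨t, ht, 0, by simpa using hr.le, by simp⟩
  have hlong : Tendsto (fun k => t₀ / ε k) atTop atTop :=
    (tendsto_inv_nhdsGT_zero.comp (tendsto_nhdsWithin_iff.2
      ⟨hεlim, Eventually.of_forall hεpos⟩)).const_mul_atTop ht₀
  by_contra! hcon
  have hseq : ∀ j : ℕ, ∃ k ≥ j, ∃ τ ∈ Icc ((j : ℝ) + 1) (t₀ / ε k),
      δ < Metric.infDist (ye k τ) (attrFiber ev (σf τ g0) (x0 (ε k * τ))) := by
    intro j
    obtain ⟨k₀, hk₀, hj⟩ := ((hlong.eventually_gt_atTop (2 * ((j : ℝ) + 1))).and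
      (eventually_ge_atTop j)).exists
    obtain ⟨k, hk, h⟩ := hcon ((j : ℝ) + 1) (by positivity) k₀ hk₀
    exact ⟨k, hj.trans hk, h⟩
  choose k hkge τ hτ hbad using hseq
  set U : Ultrafilter ℕ := hyperfilter ℕ
  have hU : (U : Filter ℕ) ≤ atTop := Nat.hyperfilter_le_atTop
  have hk : Tendsto k U atTop := (tendsto_atTop_mono hkge tendsto_id).mono_left hU
  have hτlim : Tendsto τ U atTop :=
    (tendsto_atTop_mono (fun j => by linarith [(hτ j).1])
      (tendsto_natCast_atTop_atTop (R := ℝ))).mono_left hU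
  have hετ : ∀ j, ε (k j) * τ j ∈ Icc 0 t₀ := fun j => by
    have hε := hεpos (k j)
    have h := (hτ j).2
    rw [le_div_iff₀ hε] at h
    exact ⟨mul_nonneg hε.le (by linarith [(hτ j).1, Nat.cast_nonneg (α := ℝ) j]), by linarith⟩
  obtain ⟨h, -, hh⟩ := exists_mem_tendsto_of_isCompact U (isCompact_univ (X := H))
    (u := fun j => σf (τ j) g0) (by simp)
  obtain ⟨t, htI, ht⟩ := exists_mem_tendsto_of_isCompact U
    (isCompact_Icc (a := (0 : ℝ)) (b := t₀)) (u := fun j => ε (k j) * τ j)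
    (Eventually.of_forall hετ)
  obtain ⟨z, hz, hzlim⟩ := exists_mem_attrFiber_tendsto hσcont hσ0 hσadd hev.continuous hg0 hequiv
    hsolinit hsolode hlipH hεpos hεlim hyeode hx0cont hconv hk hτlim
    (Eventually.of_forall fun j => (hτ j).2) htI ht hh
    ((hk.eventually_ge_atTop k₁).mono fun j hj => hR _ hj)
    (fun h τ hτ y₀ hy => hTb h t htI τ hτ y₀ (hy.trans (le_max_left _ _)))
  have hx0lim : Tendsto (fun j => x0 (ε (k j) * τ j)) U (𝓝 (x0 t)) :=
    (hx0cont t htI).tendsto.comp (tendsto_nhdsWithin_iff.2 ⟨ht, Eventually.of_forall hετ⟩)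
  have hhaus := (hcont (h, x0 t) (htube t htI)).comp (tendsto_nhdsWithin_iff.2
    ⟨hh.prodMk_nhds hx0lim, Eventually.of_forall fun j => htube _ (hετ j)⟩)
  obtain ⟨j, hj₁, hj₂⟩ := ((Metric.tendsto_nhds.1 hzlim (δ / 2) (half_pos hδ)).and
    (hhaus.eventually_lt_const (half_pos hδ))).exists
  have hne : (attrFiber ev (σf (τ j) g0) (x0 (ε (k j) * τ j))).Nonempty := by
    by_contra! hempty
    have := hbad j
    rw [hempty, Metric.infDist_empty] at this
    exact hδ.not_gt this
  have hfin := Metric.hausdorffEDist_ne_top_of_nonempty_of_bounded ⟨z, hz⟩ hne (hfib h t htI)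
    (hfib _ _ (hετ j))
  have e := Metric.infDist_le_infDist_add_hausdorffDist (x := ye (k j) (τ j)) hfin
  rw [Metric.hausdorffDist_comm] at e
  have e' := Metric.infDist_le_dist_of_mem (x := ye (k j) (τ j)) hz
  simp only [Function.comp_apply] at hj₂
  linarith [hbad j]
end
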